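/- Let c > 1 with c not an integer, F(t) = t^c, F'(t) = c t^{c−1}, f(k) = ⌊F(k)⌋, and 𝔠 = Σ_{n=1}^{∞} μ(n)²/(n φ(n)). For every A > 1 there exist B > 0, κ > 0 and x₀ ≥ 2 (depending only on c and A) such that for all x ≥ x₀, with y₁ defined by y₁^c = x (log x)^{−B}, and all y with y₁ < y and F(y) ≤ x, one has | Σ_{y₁ < k ≤ y} F'(k)/φ(f(k)) − 𝔠 log( f(y)/f(y₁) ) | ≤ κ (log x)^{−A}, where k runs over integers. -/

import Mathlib

/-- `𝔠 = Σ_{n=1}^∞ μ(n)²/(n φ(n))` (the `n = 0` term vanishes). -/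
noncomputable def frakc : ℝ :=
  ∑' n : ℕ, ((ArithmeticFunction.moebius n : ℝ)) ^ 2 / ((n : ℝ) * (Nat.totient n : ℝ))

section

open Finset Filter

/-- The additive character `e(x) = exp(2πix)`. -/
noncomputable def addE (x : ℝ) : ℂ := Complex.exp ((2 * Real.pi * x : ℝ) * Complex.I)

lemma addE_add (x y : ℝ) : addE (x + y) = addE x * addE y := by
  rw [addE, addE, addE, ← Complex.exp_add]
  push_cast
  ring_nf

lemma addE_zero : addE 0 = 1 := by simp [addE]

lemma norm_addE (x : ℝ) : ‖addE x‖ = 1 := Complex.norm_exp_ofReal_mul_I _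


lemma addE_neg (x : ℝ) : addE (-x) = (addE x)⁻¹ := by
  rw [addE, addE, ← Complex.exp_neg]
  push_cast
  ring_nf

lemma conj_addE (x : ℝ) : (starRingEnd ℂ) (addE x) = addE (-x) := by
  rw [addE_neg, Complex.inv_def, Complex.normSq_eq_norm_sq, norm_addE]
  simp

lemma addE_sub (x y : ℝ) : addE (x - y) = addE x * (starRingEnd ℂ) (addE y) := by
  rw [sub_eq_add_neg, addE_add, conj_addE]

lemma addE_intCast (n : ℤ) : addE n = 1 := by
  rw [addE, Complex.exp_eq_one_iff]
  exact ⟨n, by push_cast; ring⟩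

lemma addE_nat_mul (n : ℕ) (x : ℝ) : addE (n * x) = addE x ^ n := by
  rw [addE, addE, ← Complex.exp_nat_mul]
  push_cast
  ring_nf

lemma norm_addE_sub_one_le (x : ℝ) : ‖addE x - 1‖ ≤ 2 * Real.pi * |x| := by
  have h := Real.norm_exp_I_mul_ofReal_sub_one_le (x := 2 * Real.pi * x)
  rw [addE, mul_comm]
  refine h.trans (le_of_eq ?_)
  rw [Real.norm_eq_abs, abs_mul, abs_of_pos Real.two_pi_pos]

lemma le_norm_addE_sub_one {x : ℝ} (hx : |x| ≤ 1 / 2) : 4 * |x| ≤ ‖addE x - 1‖ := by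
  have h := Complex.norm_exp_I_mul_ofReal_sub_one (2 * Real.pi * x)
  rw [addE, mul_comm _ Complex.I, h, norm_mul, Real.norm_eq_abs, Real.norm_eq_abs]
  have h2 := Real.mul_abs_le_abs_sin (x := 2 * Real.pi * x / 2) (by
    rw [show 2 * Real.pi * x / 2 = Real.pi * x by ring, abs_mul, abs_of_pos Real.pi_pos]
    nlinarith [Real.pi_pos])
  rw [show |2 * Real.pi * x / 2| = Real.pi * |x| by
    rw [show 2 * Real.pi * x / 2 = Real.pi * x by ring, abs_mul, abs_of_pos Real.pi_pos]] at h2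
  have h3 : 2 / Real.pi * (Real.pi * |x|) = 2 * |x| := by
    field_simp
  rw [h3] at h2
  rw [abs_of_pos (by norm_num : (0:ℝ) < 2)]
  linarith

lemma norm_addE_sub_le (x y : ℝ) : ‖addE x - addE y‖ ≤ 2 * Real.pi * |x - y| := by
  have : addE x - addE y = addE y * (addE (x - y) - 1) := by
    rw [mul_sub, ← addE_add]
    simp
  rw [this, norm_mul, norm_addE, one_mul]
  exact norm_addE_sub_one_le _

lemma sum_norm_sq_expand {ι : Type*} (s : Finset ι) (H : ℕ) (v : ι → ℕ → ℂ) :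
    ((∑ n ∈ s, ‖∑ j ∈ range H, v n j‖ ^ 2 : ℝ) : ℂ) =
      ∑ j ∈ range H, ∑ i ∈ range H, ∑ n ∈ s, v n j * (starRingEnd ℂ) (v n i) := by
  have h (n : ι) : ((‖∑ j ∈ range H, v n j‖ ^ 2 : ℝ) : ℂ) =
      ∑ j ∈ range H, ∑ i ∈ range H, v n j * (starRingEnd ℂ) (v n i) := by
    rw [Complex.ofReal_pow, ← Complex.mul_conj', map_sum, sum_mul_sum]
  rw [Complex.ofReal_sum, sum_congr rfl fun n _ => h n, sum_comm]
  exact sum_congr rfl fun j _ => sum_comm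

/-- A sum of squares of exponential sums, bounded through its diagonal and off-diagonal terms. -/
lemma sum_norm_sq_le {ι : Type*} (s : Finset ι) (H : ℕ) (v : ι → ℕ → ℂ) (X E : ℝ) (hE : 0 ≤ E)
    (hdiag : ∀ j < H, ‖∑ n ∈ s, v n j * (starRingEnd ℂ) (v n j)‖ ≤ X)
    (hoff : ∀ j < H, ∀ i < j, ‖∑ n ∈ s, v n j * (starRingEnd ℂ) (v n i)‖ ≤ E) :
    ∑ n ∈ s, ‖∑ j ∈ range H, v n j‖ ^ 2 ≤ H * X + (H : ℝ) ^ 2 * E := by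
  have h0 : ∑ n ∈ s, ‖∑ j ∈ range H, v n j‖ ^ 2 =
      ‖((∑ n ∈ s, ‖∑ j ∈ range H, v n j‖ ^ 2 : ℝ) : ℂ)‖ := by
    rw [Complex.norm_real, Real.norm_eq_abs, abs_of_nonneg]
    positivity
  rw [h0, sum_norm_sq_expand]
  have hoff' : ∀ j < H, ∀ i < H, i ≠ j →
      ‖∑ n ∈ s, v n j * (starRingEnd ℂ) (v n i)‖ ≤ E := by
    intro j hj i hi hij
    rcases lt_or_gt_of_ne hij with h | h
    · exact hoff j hj i h
    · have := hoff i hi j h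
      rw [← Complex.norm_conj, map_sum]
      convert this using 3 with n
      rw [map_mul, Complex.conj_conj, mul_comm]
  have hX : ∀ j ∈ range H, ∀ i ∈ range H,
      ‖∑ n ∈ s, v n j * (starRingEnd ℂ) (v n i)‖ ≤ (if i = j then X else 0) + E := by
    intro j hj i hi
    split_ifs with hij
    · subst hij
      linarith [hdiag i (mem_range.1 hi)]
    · simpa using hoff' j (mem_range.1 hj) i (mem_range.1 hi) hij
  calc _ ≤ ∑ j ∈ range H, ∑ i ∈ range H, ((if i = j then X else 0) + E) :=
        (norm_sum_le _ _).trans <| sum_le_sum fun j hj =>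
          (norm_sum_le _ _).trans <| sum_le_sum fun i hi => hX j hj i hi
    _ = ∑ j ∈ range H, (X + H * E) := by
        refine sum_congr rfl fun j hj => ?_
        rw [sum_add_distrib, sum_ite_eq' (range H) j, if_pos hj]
        simp
    _ = _ := by
        simp
        ring

lemma sum_Ioc_shift {M : Type*} [AddCommMonoid M] (f : ℤ → M) (a b m : ℤ) :
    ∑ n ∈ Ioc a b, f (n + m) = ∑ n ∈ Ioc (a + m) (b + m), f n := by
  rw [← Finset.image_add_right_Ioc, sum_image]
  intro x _ y _ h
  simpa using h

/-- Van der Corput's inequality. -/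
lemma vanDerCorput (z : ℤ → ℂ) (hz : ∀ k, ‖z k‖ = 1) (a b : ℤ) (H : ℕ) (hH : 0 < H) (T E : ℝ)
    (hT : 0 ≤ T) (hab : ((b - a : ℤ) : ℝ) ≤ T) (hE0 : 0 ≤ E)
    (hE : ∀ r : ℕ, 1 ≤ r → r < H →
      ‖∑ k ∈ Ioc a (b - r), z (k + r) * (starRingEnd ℂ) (z k)‖ ≤ E) :
    ‖∑ k ∈ Ioc a b, z k‖ ^ 2 ≤ (T + H) * (T / H + E) := by
  set w : ℤ → ℂ := fun k => if k ∈ Ioc a b then z k else 0 with hw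
  set U := Ioc (a - H) b with hU
  have hshift (j : ℕ) (hj : j < H) : ∑ n ∈ U, w (n + j) = ∑ k ∈ Ioc a b, z k := by
    rw [hU, sum_Ioc_shift w, hw, ← sum_filter]
    refine sum_congr ?_ fun _ _ => rfl
    ext k
    simp only [mem_filter, mem_Ioc]
    omega
  have hsum : ∑ n ∈ U, ∑ j ∈ range H, w (n + j) = H * ∑ k ∈ Ioc a b, z k := by
    rw [sum_comm, sum_congr rfl fun j hj => hshift j (mem_range.1 hj)]
    simp
  have hcorr (j : ℕ) (hj : j < H) (i : ℕ) (hi : i ≤ j) :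
      ∑ n ∈ U, w (n + j) * (starRingEnd ℂ) (w (n + i)) =
        ∑ k ∈ Ioc a (b - (j - i : ℕ)), z (k + (j - i : ℕ)) * (starRingEnd ℂ) (z k) := by
    have h1 : ∑ n ∈ U, w (n + j) * (starRingEnd ℂ) (w (n + i)) =
        ∑ n ∈ U, (fun k => w (k + (j - i : ℕ)) * (starRingEnd ℂ) (w k)) (n + i) := by
      refine sum_congr rfl fun n _ => ?_
      simp only
      rw [show n + (i : ℤ) + ((j - i : ℕ) : ℤ) = n + j by omega]
    rw [h1, hU, sum_Ioc_shift (fun k => w (k + (j - i : ℕ)) * (starRingEnd ℂ) (w k))]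
    symm
    refine sum_subset_zero_on_sdiff ?_ ?_ ?_
    · intro k
      simp only [mem_Ioc]
      omega
    · intro k hk
      simp only [Finset.mem_sdiff, mem_Ioc] at hk
      simp only [hw, mem_Ioc]
      split_ifs <;> first | omega | simp
    · intro k hk
      simp only [mem_Ioc] at hk
      simp only [hw, mem_Ioc]
      rw [if_pos (by omega), if_pos (by omega)]
  have hsq := sum_norm_sq_le U H (fun n j => w (n + j)) T E hE0 (by
      intro j hj
      rw [hcorr j hj j le_rfl]
      refine (norm_sum_le _ _).trans ?_
      simp only [norm_mul, Complex.norm_conj, hz, mul_one, sum_const, Int.card_Ioc, nsmul_eq_mul]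
      rcases le_total a b with h | h
      · calc (((b - ((j - j : ℕ) : ℤ) - a).toNat : ℕ) : ℝ) = ((b - a : ℤ) : ℝ) := by
              rw [← Int.cast_natCast, Int.toNat_of_nonneg (by omega)]
              simp
          _ ≤ T := hab
      · rw [Int.toNat_of_nonpos (by omega)]
        simpa using hT) (by
      intro j hj i hi
      rw [hcorr j hj i hi.le]
      exact hE _ (by omega) (by omega))
  have hcard : (#U : ℝ) ≤ T + H := by
    rw [hU, Int.card_Ioc]
    rcases le_total 0 (b - (a - H)) with h | h
    · rw [← Int.cast_natCast, Int.toNat_of_nonneg h]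
      push_cast at hab ⊢
      linarith
    · rw [Int.toNat_of_nonpos h, Nat.cast_zero]
      positivity
  have hCS : ‖∑ n ∈ U, ∑ j ∈ range H, w (n + j)‖ ^ 2 ≤
      #U * ∑ n ∈ U, ‖∑ j ∈ range H, w (n + j)‖ ^ 2 :=
    (pow_le_pow_left₀ (norm_nonneg _) (norm_sum_le _ _) 2).trans sq_sum_le_card_mul_sum_sq
  rw [hsum, norm_mul, Complex.norm_natCast] at hCS
  have hHpos : (0 : ℝ) < H := by exact_mod_cast hH
  have h3 : ((H : ℝ) * ‖∑ k ∈ Ioc a b, z k‖) ^ 2 ≤ (T + H) * (H * T + (H : ℝ) ^ 2 * E) :=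
    hCS.trans (mul_le_mul hcard hsq (by positivity) (by positivity))
  have h4 : (T + H) * (H * T + (H : ℝ) ^ 2 * E) = (H : ℝ) ^ 2 * ((T + H) * (T / H + E)) := by
    field_simp
  rw [h4, mul_pow] at h3
  exact le_of_mul_le_mul_left h3 (by positivity)

/-- A weak form of the Kusmin–Landau inequality. -/
lemma kusminLandau (g : ℤ → ℝ) (a b : ℤ) (T l κ : ℝ) (hT : 0 ≤ T) (hab : ((b - a : ℤ) : ℝ) ≤ T)
    (hl : 0 < l) (hκ : 0 ≤ κ)
    (h1 : ∀ k ∈ Ioc a (b + 1), l ≤ |g (k + 1) - g k|)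
    (h2 : ∀ k ∈ Ioc a (b + 1), |g (k + 1) - g k| ≤ 1 / 2)
    (h3 : ∀ k ∈ Ioc a b, |g (k + 2) - g (k + 1) - (g (k + 1) - g k)| ≤ κ) :
    ‖∑ k ∈ Ioc a b, addE (g k)‖ ≤ 1 / l + T * κ / l ^ 2 := by
  rcases lt_or_ge b a with hba | hba
  · rw [Ioc_eq_empty (by omega)]
    simp
    positivity
  set θ : ℤ → ℝ := fun k => g (k + 1) - g k with hθ
  set u : ℤ → ℂ := fun k => (addE (θ k) - 1)⁻¹ with hu
  have hge (k : ℤ) (hk : k ∈ Ioc a (b + 1)) : 4 * l ≤ ‖addE (θ k) - 1‖ :=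
    le_trans (by linarith [h1 k hk]) (le_norm_addE_sub_one (h2 k hk))
  have hne (k : ℤ) (hk : k ∈ Ioc a (b + 1)) : addE (θ k) - 1 ≠ 0 := by
    rw [← norm_pos_iff]
    linarith [hge k hk]
  have hub (k : ℤ) (hk : k ∈ Ioc a (b + 1)) : ‖u k‖ ≤ 1 / (4 * l) := by
    rw [hu, norm_inv, ← one_div]
    exact one_div_le_one_div_of_le (by positivity) (hge k hk)
  have hdiff (k : ℤ) (hk : k ∈ Ioc a b) : ‖u k - u (k + 1)‖ ≤ κ / (2 * l ^ 2) := by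
    have hk1 : k ∈ Ioc a (b + 1) := by simp only [mem_Ioc] at hk ⊢; omega
    have hk2 : k + 1 ∈ Ioc a (b + 1) := by simp only [mem_Ioc] at hk ⊢; omega
    have : u k - u (k + 1) = (addE (θ (k + 1)) - addE (θ k)) * (u k * u (k + 1)) := by
      simp only [hu]
      have := hne k hk1
      have := hne (k + 1) hk2
      field_simp
      ring
    rw [this, norm_mul, norm_mul]
    have h5 : ‖addE (θ (k + 1)) - addE (θ k)‖ ≤ 8 * κ := by
      refine (norm_addE_sub_le _ _).trans ?_
      have h6 := h3 k hk
      simp only [hθ, add_assoc]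
      norm_num
      nlinarith [Real.pi_lt_four, Real.pi_pos, abs_nonneg (g (k + 2) - g (k + 1) - (g (k + 1) - g k))]
    calc _ ≤ 8 * κ * (1 / (4 * l) * (1 / (4 * l))) :=
          mul_le_mul h5 (mul_le_mul (hub k hk1) (hub _ hk2) (norm_nonneg _) (by positivity))
            (by positivity) (by positivity)
      _ = _ := by field_simp; ring
  have key (n : ℕ) (hn : a + n ≤ b) :
      ‖∑ k ∈ Ioc a (a + n), addE (g k) - addE (g (a + n + 1)) * u (a + n + 1)‖ ≤
        1 / (4 * l) + n * (κ / (2 * l ^ 2)) := by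
    induction n with
    | zero =>
      simp only [Nat.cast_zero, add_zero, Ioc_self, sum_empty, zero_sub, norm_neg, norm_mul,
        norm_addE, one_mul, zero_mul]
      exact hub _ (by simp only [mem_Ioc]; omega)
    | succ n ih =>
      have ih := ih (by push_cast at hn; omega)
      have hmem : a + n + 1 ∈ Ioc a b := by push_cast at hn; simp only [mem_Ioc]; omega
      have hI : Ioc a (a + (n + 1 : ℕ)) = insert (a + n + 1) (Ioc a (a + n)) := by
        ext k
        simp only [mem_Ioc, mem_insert]
        push_cast
        omega
      rw [hI, sum_insert (by simp)]
      have h6 : addE (g (a + n + 1)) + addE (g (a + n + 1)) * u (a + n + 1) =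
          addE (g (a + n + 1 + 1)) * u (a + n + 1) := by
        have h7 : addE (g (a + n + 1 + 1)) =
            addE (g (a + n + 1)) * addE (θ (a + n + 1)) := by
          rw [← addE_add]
          simp only [hθ]
          ring_nf
        have h8 : addE (θ (a + n + 1)) * u (a + n + 1) = 1 + u (a + n + 1) := by
          have := hne (a + n + 1) (by simp only [mem_Ioc] at hmem ⊢; omega)
          simp only [hu]
          field_simp
          ring
        rw [h7, mul_assoc, h8]
        ring
      have h9 : addE (g (a + n + 1)) + ∑ k ∈ Ioc a (a + n), addE (g k) -
          addE (g (a + (n + 1 : ℕ) + 1)) * u (a + (n + 1 : ℕ) + 1) =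
          (∑ k ∈ Ioc a (a + n), addE (g k) - addE (g (a + n + 1)) * u (a + n + 1)) +
          addE (g (a + n + 1 + 1)) * (u (a + n + 1) - u (a + n + 1 + 1)) := by
        rw [mul_sub, ← h6]
        push_cast
        rw [← add_assoc a]
        ring
      rw [h9]
      refine (norm_add_le _ _).trans ?_
      rw [norm_mul, norm_addE, one_mul]
      have := hdiff _ hmem
      push_cast
      linarith
  obtain ⟨n, hn⟩ : ∃ n : ℕ, b = a + n := ⟨(b - a).toNat, by omega⟩
  have hk := key n hn.ge
  rw [← hn] at hk
  have hnT : (n : ℝ) ≤ T := by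
    rw [hn] at hab
    simpa using hab
  have h10 := norm_le_norm_sub_add (∑ k ∈ Ioc a b, addE (g k)) (addE (g (b + 1)) * u (b + 1))
  rw [norm_mul (addE _), norm_addE, one_mul] at h10
  have h11 := hub (b + 1) (by simp only [mem_Ioc]; omega)
  have h12 : (n : ℝ) * (κ / (2 * l ^ 2)) ≤ T * κ / l ^ 2 := by
    calc (n : ℝ) * (κ / (2 * l ^ 2)) ≤ T * (κ / (1 * l ^ 2)) := by gcongr; norm_num
      _ = _ := by ring
  have h13 : 1 / (4 * l) + 1 / (4 * l) ≤ 1 / l := by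
    have : 1 / (4 * l) + 1 / (4 * l) = 1 / l / 2 := by field_simp; norm_num
    rw [this]
    have : 0 < 1 / l := by positivity
    linarith
  linarith

/-- The iterated forward difference of `f` with the given list of steps. -/
def iterDiff : List ℕ → (ℝ → ℝ) → ℝ → ℝ
  | [], f => f
  | h :: hs, f => iterDiff hs fun t => f (t + h) - f t

lemma iterDiff_shift_sub (hs : List ℕ) (f : ℝ → ℝ) (h : ℕ) (t : ℝ) :
    iterDiff hs f (t + h) - iterDiff hs f t = iterDiff (h :: hs) f t := by
  induction hs generalizing f with
  | nil => rfl
  | cons r hs ih =>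
    simp only [iterDiff] at ih ⊢
    rw [ih]
    congr 1
    funext t
    rw [show t + r + h = t + h + r by ring]
    ring

/-- Mean value theorem for iterated differences: `F i` is the `i`-th derivative of `F 0`. -/
lemma exists_iterDiff_eq (hs : List ℕ) (F : ℕ → ℝ → ℝ)
    (hF : ∀ i, ∀ t > 0, HasDerivAt (F i) (F (i + 1) t) t) (t : ℝ) (ht : 0 < t) :
    ∃ ξ, t ≤ ξ ∧ ξ ≤ t + hs.sum ∧ iterDiff hs (F 0) t = hs.prod * F hs.length ξ := by
  induction hs generalizing F with
  | nil => exact ⟨t, le_rfl, by simp, by simp [iterDiff]⟩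
  | cons h hs ih =>
    obtain ⟨ξ, h1, h2, h3⟩ := ih (fun i t => F i (t + h) - F i t) (by
      intro i t ht
      exact ((hF i (t + h) (by positivity)).comp_add_const t (h : ℝ)).sub (hF i t ht))
    rcases Nat.eq_zero_or_pos h with h0 | h0
    · refine ⟨ξ, h1, h2.trans ?_, ?_⟩
      · simp [h0]
      · simp only [iterDiff]
        rw [h3]
        simp [h0]
    · have hpos : (0 : ℝ) < h := by exact_mod_cast h0
      obtain ⟨ζ, hζ, hζ'⟩ := exists_hasDerivAt_eq_slope (F hs.length) (F (hs.length + 1))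
        (show ξ < ξ + h by linarith)
        (fun x hx => (hF _ x (by linarith [hx.1])).continuousAt.continuousWithinAt)
        (fun x hx => hF _ x (by linarith [hx.1]))
      refine ⟨ζ, by linarith [hζ.1], ?_, ?_⟩
      · simp only [List.sum_cons, Nat.cast_add]
        linarith [hζ.2]
      · simp only [iterDiff, List.prod_cons, List.length_cons, Nat.cast_mul]
        rw [h3, hζ', add_sub_cancel_left]
        field_simp

/-- Repeated application of Van der Corput's inequality. -/
lemma norm_sum_addE_le_of_iterDiff (q H : ℕ) (hH : 0 < H) (T : ℝ) (hHT : (H : ℝ) ≤ T) (c₁ c₂ : ℤ)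
    (hc : ((c₂ - c₁ : ℤ) : ℝ) ≤ T) (f : ℝ → ℝ)
    (hf : ∀ hs : List ℕ, hs.length = q → (∀ h ∈ hs, 1 ≤ h ∧ h ≤ H) → ∀ a b : ℤ, c₁ ≤ a → b ≤ c₂ →
      ‖∑ k ∈ Ioc a b, addE (iterDiff hs f k)‖ ≤ T / H) (a b : ℤ) (ha : c₁ ≤ a) (hb : b ≤ c₂) :
    ‖∑ k ∈ Ioc a b, addE (f k)‖ ≤ 6 * T * (H : ℝ) ^ (-((1 / 2 : ℝ) ^ q)) := by
  have hH1 : (1 : ℝ) ≤ H := by exact_mod_cast hH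
  have hT : 0 < T := by linarith
  induction q generalizing f a b with
  | zero =>
    have := hf [] rfl (by simp) a b ha hb
    rw [pow_zero, Real.rpow_neg_one]
    simp only [iterDiff] at this
    rw [div_eq_mul_inv] at this
    nlinarith [inv_pos.2 (show (0 : ℝ) < H by linarith)]
  | succ q ih =>
    set ρ : ℝ := (H : ℝ) ^ (-((1 / 2 : ℝ) ^ (q + 1))) with hρ
    have hρ0 : 0 < ρ := Real.rpow_pos_of_pos (by linarith) _
    have hρ2 : ρ ^ 2 = (H : ℝ) ^ (-((1 / 2 : ℝ) ^ q)) := by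
      rw [hρ, ← Real.rpow_natCast, ← Real.rpow_mul (by linarith)]
      congr 1
      push_cast
      rw [pow_succ]
      ring
    have hHρ : 1 / (H : ℝ) ≤ ρ ^ 2 := by
      rw [hρ2, one_div, ← Real.rpow_neg_one]
      refine Real.rpow_le_rpow_of_exponent_le hH1 ?_
      have := pow_le_one₀ (n := q) (by norm_num : (0 : ℝ) ≤ 1 / 2) (by norm_num)
      linarith
    have hvdc := vanDerCorput (fun k => addE (f k)) (fun k => norm_addE _) a b H hH T
      (6 * T * ρ ^ 2) hT.le (by
        refine le_trans ?_ hc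
        exact_mod_cast (by omega : b - a ≤ c₂ - c₁)) (by positivity) (by
        intro r hr1 hrH
        rw [hρ2]
        refine le_trans (le_of_eq ?_) (ih (fun t => f (t + r) - f t) ?_ a (b - r) ha (by omega))
        · congr 1
          refine sum_congr rfl fun k _ => ?_
          rw [← addE_sub]
          push_cast
          rfl
        · intro hs hlen hmem
          refine hf (r :: hs) (by simp [hlen]) ?_
          intro h hh
          rcases List.mem_cons.1 hh with rfl | hh
          · exact ⟨hr1, hrH.le⟩
          · exact hmem h hh)
    have h2 : ‖∑ k ∈ Ioc a b, addE (f k)‖ ^ 2 ≤ (6 * T * ρ) ^ 2 := by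
      refine hvdc.trans ?_
      calc (T + H) * (T / H + 6 * T * ρ ^ 2) ≤ (T + T) * (T * ρ ^ 2 + 6 * T * ρ ^ 2) := by
            rw [div_eq_mul_one_div]
            gcongr
        _ ≤ _ := by nlinarith [sq_nonneg (T * ρ)]
    exact le_of_sq_le_sq h2 (by positivity)

/-- The coefficient `c (c - 1) ⋯ (c - i + 1)` of the `i`-th derivative of `t ^ c`. -/
def fallCoeff (c : ℝ) (i : ℕ) : ℝ := ∏ j ∈ range i, (c - j)

lemma fallCoeff_ne_zero {c : ℝ} (hc : ∀ n : ℤ, c ≠ n) (i : ℕ) : fallCoeff c i ≠ 0 := by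
  rw [fallCoeff, prod_ne_zero_iff]
  intro j _ h
  exact hc j (by push_cast; linarith)

lemma hasDerivAt_fallCoeff (α c : ℝ) (i : ℕ) (t : ℝ) (ht : 0 < t) :
    HasDerivAt (fun t => α * fallCoeff c i * t ^ (c - i))
      (α * fallCoeff c (i + 1) * t ^ (c - (i + 1 : ℕ))) t := by
  have h := (Real.hasDerivAt_rpow_const (x := t) (p := c - i) (Or.inl ht.ne')).const_mul
    (α * fallCoeff c i)
  have hv : α * fallCoeff c (i + 1) * t ^ (c - (i + 1 : ℕ)) =
      α * fallCoeff c i * ((c - i) * t ^ (c - i - 1)) := by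
    rw [show fallCoeff c (i + 1) = fallCoeff c i * (c - i) from prod_range_succ _ _]
    push_cast
    rw [sub_sub]
    ring
  rw [hv]
  exact h

lemma abs_iterDiff_rpow (α c : ℝ) (hα : 0 ≤ α) (hs : List ℕ) (t : ℝ) (ht : 0 < t) :
    ∃ ξ, t ≤ ξ ∧ ξ ≤ t + hs.sum ∧ |iterDiff hs (fun t => α * t ^ c) t| =
      hs.prod * (α * |fallCoeff c hs.length| * ξ ^ (c - hs.length)) := by
  obtain ⟨ξ, h1, h2, h3⟩ := exists_iterDiff_eq hs (fun i t => α * fallCoeff c i * t ^ (c - i))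
    (fun i t ht => hasDerivAt_fallCoeff α c i t ht) t ht
  refine ⟨ξ, h1, h2, ?_⟩
  have h0 : (fun t : ℝ => α * fallCoeff c 0 * t ^ (c - (0 : ℕ))) = fun t => α * t ^ c := by
    funext t
    simp [fallCoeff]
  rw [h0] at h3
  rw [h3, abs_mul, abs_mul, abs_mul, abs_of_nonneg hα, Nat.abs_cast,
    abs_of_nonneg (Real.rpow_nonneg (by linarith) _)]

lemma list_sum_le (hs : List ℕ) (P : ℕ) (h : ∀ x ∈ hs, x ≤ P) : hs.sum ≤ hs.length * P := by
  simpa using List.sum_le_card_nsmul hs P h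

lemma list_prod_le (hs : List ℕ) (P : ℕ) (h : ∀ x ∈ hs, x ≤ P) : hs.prod ≤ P ^ hs.length := by
  simpa using List.prod_le_pow_card hs P h

lemma one_le_list_prod (hs : List ℕ) (h : ∀ x ∈ hs, 1 ≤ x) : 1 ≤ hs.prod :=
  List.one_le_prod_of_one_le h

/-- One-variable bound behind the exponential sum estimate, after `q` differencing steps. -/
lemma norm_sum_iterDiff_rpow_le (c : ℝ) (q : ℕ) (σ : ℝ) (hσ0 : 0 < σ) (hσ1 : σ < 1)
    (hcσ : c - (q + 1 : ℕ) = -σ) (T : ℝ) (P : ℕ) (hP : 1 ≤ P)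
    (hPT : 3 + (q : ℝ) * P ≤ T) (K K₂ : ℝ) (hK : K = |fallCoeff c (q + 1)|) (hK0 : 0 < K)
    (hK2 : K₂ = |fallCoeff c (q + 2)|)
    (hsmall : 2 * K * (P : ℝ) ^ (q + 2) ≤ T ^ σ)
    (α : ℝ) (hα1 : 1 / (P : ℝ) ≤ α) (hα2 : α ≤ P) (hs : List ℕ) (hlen : hs.length = q)
    (hmem : ∀ h ∈ hs, 1 ≤ h ∧ h ≤ P) (a b : ℤ) (ha : T / P ≤ a) (hb : (b : ℝ) ≤ T) :
    ‖∑ k ∈ Ioc a b, addE (iterDiff hs (fun t => α * t ^ c) k)‖ ≤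
      (2 / K + 4 * K₂ / K ^ 2) * (P : ℝ) ^ (q + 5) * T ^ σ := by
  have hP1 : (1 : ℝ) ≤ P := by exact_mod_cast hP
  have hP0 : (0 : ℝ) < P := by linarith
  have hT : 3 ≤ T := by nlinarith [Nat.cast_nonneg (α := ℝ) q]
  have hT0 : 0 < T := by linarith
  have hα0 : 0 < α := lt_of_lt_of_le (by positivity) hα1
  have hTP : 0 < T / P := by positivity
  have hsum : ((hs.sum : ℕ) : ℝ) ≤ q * P := by
    have := list_sum_le hs P fun x hx => (hmem x hx).2
    rw [hlen] at this
    exact_mod_cast this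
  have hprod1 : (1 : ℝ) ≤ (hs.prod : ℕ) := by
    exact_mod_cast one_le_list_prod hs fun x hx => (hmem x hx).1
  have hprod2 : ((hs.prod : ℕ) : ℝ) ≤ (P : ℝ) ^ q := by
    have := list_prod_le hs P fun x hx => (hmem x hx).2
    rw [hlen] at this
    exact_mod_cast this
  have hK20 : 0 ≤ K₂ := hK2 ▸ abs_nonneg _
  set g : ℤ → ℝ := fun k => iterDiff hs (fun t => α * t ^ c) k with hg
  have hd1 (k : ℤ) : g (k + 1) - g k = iterDiff (1 :: hs) (fun t => α * t ^ c) k := by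
    rw [← iterDiff_shift_sub]
    simp [hg]
  have hd2 (k : ℤ) : g (k + 2) - g (k + 1) - (g (k + 1) - g k) =
      iterDiff (1 :: 1 :: hs) (fun t => α * t ^ c) k := by
    rw [← iterDiff_shift_sub, ← hd1, show (k : ℝ) + (1 : ℕ) = ((k + 1 : ℤ) : ℝ) by push_cast; rfl,
      ← hd1]
    ring_nf
  set l : ℝ := K / (2 * P) * T ^ (-σ) with hl
  set κ : ℝ := K₂ * (P : ℝ) ^ (q + 3) * T ^ (-σ - 1) with hκ
  have hl0 : 0 < l := by positivity
  have hκ0 : 0 ≤ κ := by positivity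
  have hTPσ : (T / P) ^ (-σ) ≤ P * T ^ (-σ) := by
    rw [Real.div_rpow hT0.le hP0.le, Real.rpow_neg hP0.le, div_inv_eq_mul, mul_comm]
    gcongr
    calc (P : ℝ) ^ σ ≤ (P : ℝ) ^ (1 : ℝ) := Real.rpow_le_rpow_of_exponent_le hP1 hσ1.le
      _ = P := Real.rpow_one _
  have hTPσ1 : (T / P) ^ (-σ - 1) ≤ (P : ℝ) ^ 2 * T ^ (-σ - 1) := by
    rw [show -σ - 1 = -(σ + 1) by ring, Real.div_rpow hT0.le hP0.le, Real.rpow_neg hP0.le,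
      div_inv_eq_mul, mul_comm]
    gcongr
    calc (P : ℝ) ^ (σ + 1) ≤ (P : ℝ) ^ (2 : ℝ) :=
          Real.rpow_le_rpow_of_exponent_le hP1 (by linarith)
      _ = (P : ℝ) ^ 2 := by norm_cast
  have hkey1 (k : ℤ) (hk : k ∈ Ioc a (b + 1)) :
      l ≤ |g (k + 1) - g k| ∧ |g (k + 1) - g k| ≤ K * (P : ℝ) ^ (q + 2) * T ^ (-σ) := by
    rw [mem_Ioc] at hk
    have hka : (a : ℝ) ≤ k := by exact_mod_cast hk.1.le
    have hkb : (k : ℝ) ≤ b + 1 := by exact_mod_cast hk.2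
    have hk0 : (0 : ℝ) < k := by linarith
    rw [hd1]
    obtain ⟨ξ, hξ1, hξ2, hξ⟩ := abs_iterDiff_rpow α c hα0.le (1 :: hs) k hk0
    rw [hξ]
    simp only [List.prod_cons, one_mul, List.length_cons, hlen, hcσ, ← hK]
    simp only [List.sum_cons, Nat.cast_add, Nat.cast_one] at hξ2
    have hξT : T / P ≤ ξ := by linarith
    have hξT2 : ξ ≤ 2 * T := by linarith
    have hξ0 : 0 < ξ := by linarith
    have hlow : T ^ (-σ) / 2 ≤ ξ ^ (-σ) := by
      calc T ^ (-σ) / 2 = T ^ (-σ) * (2 : ℝ) ^ (-1 : ℝ) := by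
            rw [Real.rpow_neg_one]; ring
        _ ≤ T ^ (-σ) * (2 : ℝ) ^ (-σ) := by
            gcongr
            · norm_num
        _ = (2 * T) ^ (-σ) := by
            rw [Real.mul_rpow (by norm_num) hT0.le, mul_comm]
        _ ≤ ξ ^ (-σ) := Real.rpow_le_rpow_of_nonpos hξ0 hξT2 (by linarith)
    have hupp : ξ ^ (-σ) ≤ P * T ^ (-σ) :=
      (Real.rpow_le_rpow_of_nonpos hTP hξT (by linarith)).trans hTPσ
    constructor
    · calc l = 1 * (1 / P * K * (T ^ (-σ) / 2)) := by rw [hl]; field_simp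
        _ ≤ _ := by gcongr
    · calc (hs.prod : ℝ) * (α * K * ξ ^ (-σ)) ≤ (P : ℝ) ^ q * (P * K * (P * T ^ (-σ))) := by
            gcongr
        _ = _ := by ring
  have h := kusminLandau g a b T l κ hT0.le (by push_cast; linarith) hl0 hκ0
    (fun k hk => (hkey1 k hk).1) (fun k hk => by
      refine (hkey1 k hk).2.trans ?_
      rw [Real.rpow_neg hT0.le, ← div_eq_mul_inv, div_le_iff₀ (by positivity)]
      linarith) (fun k hk => by
      rw [mem_Ioc] at hk
      have hka : (a : ℝ) ≤ k := by exact_mod_cast hk.1.le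
      have hk0 : (0 : ℝ) < k := by linarith
      rw [hd2]
      obtain ⟨ξ, hξ1, hξ2, hξ⟩ := abs_iterDiff_rpow α c hα0.le (1 :: 1 :: hs) k hk0
      rw [hξ]
      have hexp : c - (q + 1 + 1 : ℕ) = -σ - 1 := by
        rw [← hcσ]; push_cast; ring
      simp only [List.prod_cons, one_mul, List.length_cons, hlen, hexp]
      have hξT : T / P ≤ ξ := by linarith
      have hupp : ξ ^ (-σ - 1) ≤ (P : ℝ) ^ 2 * T ^ (-σ - 1) :=
        (Real.rpow_le_rpow_of_nonpos hTP hξT (by linarith)).trans hTPσ1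
      have hξ0 : 0 < ξ := by linarith
      rw [show q + 1 + 1 = q + 2 from rfl, ← hK2]
      calc (hs.prod : ℝ) * (α * K₂ * ξ ^ (-σ - 1)) ≤
            (P : ℝ) ^ q * (P * K₂ * ((P : ℝ) ^ 2 * T ^ (-σ - 1))) := by gcongr
        _ = κ := by rw [hκ]; ring)
  refine h.trans ?_
  have hTσ : T ^ (-σ) = (T ^ σ)⁻¹ := Real.rpow_neg hT0.le _
  have hTσ1 : T ^ (-σ - 1) = (T ^ σ)⁻¹ / T := by rw [Real.rpow_sub_one hT0.ne', hTσ]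
  have hTσ0 : 0 < T ^ σ := by positivity
  have e1 : 1 / l = 2 / K * P * T ^ σ := by
    rw [hl, hTσ]; field_simp
  have e2 : T * κ / l ^ 2 = 4 * K₂ / K ^ 2 * (P : ℝ) ^ (q + 5) * T ^ σ := by
    rw [hl, hκ, hTσ, hTσ1]
    field_simp
    ring
  rw [e1, e2]
  have : (P : ℝ) ≤ (P : ℝ) ^ (q + 5) := le_self_pow₀ hP1 (by omega)
  have : 2 / K * P * T ^ σ ≤ 2 / K * (P : ℝ) ^ (q + 5) * T ^ σ := by gcongr
  linarith

/-- Power saving for exponential sums with the phase `(h/d) k ^ c`. -/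
theorem exists_norm_sum_addE_rpow_le (c : ℝ) (hc : 1 < c) (hcne : ∀ n : ℤ, c ≠ n) :
    ∃ η : ℝ, 0 < η ∧ η ≤ 1 / 2 ∧ ∃ β : ℝ, 0 < β ∧ β ≤ 1 ∧ ∀ᶠ T : ℝ in atTop, ∀ P : ℕ, 1 ≤ P →
      (P : ℝ) ≤ T ^ η → ∀ α : ℝ, 1 / (P : ℝ) ≤ α → α ≤ P → ∀ a b : ℤ, T / P ≤ a → (b : ℝ) ≤ T →
        ‖∑ k ∈ Ioc a b, addE (α * (k : ℝ) ^ c)‖ ≤ 6 * T * (P : ℝ) ^ (-β) := by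
  obtain ⟨q, hq⟩ : ∃ q : ℕ, ⌊c⌋ = q := ⟨⌊c⌋.toNat, by
    rw [Int.toNat_of_nonneg (Int.floor_nonneg.2 (by linarith))]⟩
  have hqc : (q : ℝ) < c := by
    refine lt_of_le_of_ne ?_ (fun h => hcne q (by rw [← h]; simp))
    have := Int.floor_le c
    rw [hq] at this
    exact_mod_cast this
  have hqc' : c < q + 1 := by
    have := Int.lt_floor_add_one c
    rw [hq] at this
    exact_mod_cast this
  set σ : ℝ := q + 1 - c with hσ
  set m : ℝ := min σ (1 - σ) with hm
  have hm0 : 0 < m := lt_min (by linarith) (by linarith)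
  have hm1 : m ≤ σ := min_le_left _ _
  have hm2 : m ≤ 1 - σ := min_le_right _ _
  set η : ℝ := m / (2 * (q + 6)) with hη
  have hη0 : 0 < η := by positivity
  have hηm : η * (q + 6) = m / 2 := by rw [hη]; field_simp
  have hηhalf : η ≤ 1 / 2 := by nlinarith [Nat.cast_nonneg (α := ℝ) q]
  set K := |fallCoeff c (q + 1)| with hK
  set K₂ := |fallCoeff c (q + 2)| with hK2
  have hK0 : 0 < K := abs_pos.2 (fallCoeff_ne_zero hcne _)
  set C : ℝ := 2 / K + 4 * K₂ / K ^ 2 with hC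
  refine ⟨η, hη0, hηhalf, (1 / 2 : ℝ) ^ q, by positivity,
    pow_le_one₀ (by norm_num) (by norm_num), ?_⟩
  have t1 := (tendsto_rpow_atTop (half_pos hm0)).eventually_ge_atTop (2 * K)
  have t2 := (tendsto_rpow_atTop (half_pos hm0)).eventually_ge_atTop C
  have t3 := (tendsto_rpow_atTop (show (0 : ℝ) < 1 / 2 by norm_num)).eventually_ge_atTop
    (3 + (q : ℝ))
  filter_upwards [t1, t2, t3, eventually_ge_atTop 1] with T t1 t2 t3 hT1 P hP hPT α hα1 hα2 a b ha hb
  have hT0 : 0 < T := by linarith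
  have hP1 : (1 : ℝ) ≤ P := by exact_mod_cast hP
  have hP0 : (0 : ℝ) < P := by linarith
  have hpow : (P : ℝ) ^ (q + 6) ≤ T ^ (m / 2) := by
    calc (P : ℝ) ^ (q + 6) ≤ (T ^ η) ^ (q + 6) := by gcongr
      _ = T ^ (m / 2) := by
        rw [← Real.rpow_natCast, ← Real.rpow_mul hT0.le]
        congr 1
        push_cast
        exact hηm
  have hTm : T ^ (m / 2) * T ^ (m / 2) ≤ T ^ σ ∧ T ^ (m / 2) * T ^ (m / 2) ≤ T ^ (1 - σ) := by
    rw [← Real.rpow_add hT0, add_halves]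
    exact ⟨Real.rpow_le_rpow_of_exponent_le hT1 hm1, Real.rpow_le_rpow_of_exponent_le hT1 hm2⟩
  have hPhalf : (P : ℝ) ≤ T ^ (1 / 2 : ℝ) :=
    hPT.trans (Real.rpow_le_rpow_of_exponent_le hT1 hηhalf)
  have hhalf : T ^ (1 / 2 : ℝ) * T ^ (1 / 2 : ℝ) = T := by
    rw [← Real.rpow_add hT0]; norm_num
  have hPT' : 3 + (q : ℝ) * P ≤ T := by
    rw [← hhalf]
    calc 3 + (q : ℝ) * P ≤ (3 + q) * P := by nlinarith
      _ ≤ _ := by gcongr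
  have hC0 : 0 ≤ C := by positivity
  refine norm_sum_addE_le_of_iterDiff q P hP T ?_ a b (by push_cast; linarith [div_pos hT0 hP0])
    (fun t => α * t ^ c) ?_ a b le_rfl le_rfl
  · nlinarith [Nat.cast_nonneg (α := ℝ) q, Real.one_le_rpow hT1 (show (0 : ℝ) ≤ 1 / 2 by norm_num)]
  · intro hs hlen hmem a' b' ha' hb'
    refine (norm_sum_iterDiff_rpow_le c q σ (by linarith) (by linarith) (by push_cast; linarith)
      T P hP hPT' K K₂ hK hK0 hK2 ?_ α hα1 hα2 hs hlen hmem a' b'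
      (ha.trans (by exact_mod_cast ha')) (le_trans (by exact_mod_cast hb') hb)).trans ?_
    · refine le_trans ?_ hTm.1
      have : (P : ℝ) ^ (q + 2) ≤ (P : ℝ) ^ (q + 6) := pow_le_pow_right₀ hP1 (by omega)
      exact mul_le_mul t1 (this.trans hpow) (by positivity) (by positivity)
    · rw [le_div_iff₀ hP0]
      calc C * (P : ℝ) ^ (q + 5) * T ^ σ * P = (C * (P : ℝ) ^ (q + 6)) * T ^ σ := by ring
        _ ≤ (T ^ (m / 2) * T ^ (m / 2)) * T ^ σ := by gcongr
        _ ≤ T ^ (1 - σ) * T ^ σ := by gcongr; exact hTm.2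
        _ = T := by rw [← Real.rpow_add hT0]; norm_num

/-- The Fejér kernel of order `H`, normalised by the factor `1 / H`. -/
noncomputable def fejer (H : ℕ) (t : ℝ) : ℝ := ‖∑ h ∈ range H, addE (h * t)‖ ^ 2 / (H : ℝ) ^ 2

lemma fejer_nonneg (H : ℕ) (t : ℝ) : 0 ≤ fejer H t := by unfold fejer; positivity

lemma norm_sum_range_addE_le (H : ℕ) {t : ℝ} (ht : |t| ≤ 1 / 2) (ht0 : t ≠ 0) :
    ‖∑ h ∈ range H, addE (h * t)‖ ≤ 1 / (2 * |t|) := by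
  have h1 := le_norm_addE_sub_one ht
  have h0 : 0 < |t| := abs_pos.2 ht0
  have h2 : (addE t - 1) * ∑ h ∈ range H, addE (h * t) = addE (H * t) - 1 := by
    simp only [addE_nat_mul]
    exact mul_geom_sum _ _
  have h3 : ‖addE t - 1‖ * ‖∑ h ∈ range H, addE (h * t)‖ ≤ 2 := by
    rw [← norm_mul, h2]
    refine (norm_sub_le _ _).trans ?_
    rw [norm_addE, norm_one]
    norm_num
  rw [le_div_iff₀ (by positivity)]
  nlinarith [norm_nonneg (∑ h ∈ range H, addE (h * t))]

lemma fejer_le (H : ℕ) {t m : ℝ} (hm : 0 < m) (ht : |t * H| ≤ H / 2) (htm : m ≤ |t * H|) :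
    fejer H t ≤ 1 / (4 * m ^ 2) := by
  have hH : (0 : ℝ) < H := by linarith
  rw [abs_mul, Nat.abs_cast] at ht htm
  have h1 : |t| ≤ 1 / 2 := by nlinarith
  have h0 : 0 < |t| := by
    by_contra h
    nlinarith [abs_nonneg t]
  have h2 := norm_sum_range_addE_le H h1 (abs_pos.1 h0)
  unfold fejer
  calc _ ≤ (1 / (2 * |t|)) ^ 2 / (H : ℝ) ^ 2 := by gcongr
    _ = 1 / (4 * (|t| * H) ^ 2) := by field_simp; norm_num
    _ ≤ _ := by gcongr

lemma addE_mul_conj_nat (j i : ℕ) (hij : i ≤ j) (t : ℝ) :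
    addE (j * t) * (starRingEnd ℂ) (addE (i * t)) = addE ((j - i : ℕ) * t) := by
  rw [← addE_sub, Nat.cast_sub hij]
  ring_nf

lemma sum_fejer_eq_one (H : ℕ) (hH : 0 < H) (t : ℝ) (p : ℤ) :
    ∑ r ∈ Ioc p (p + H), fejer H (t - r / H) = 1 := by
  have hH0 : (H : ℝ) ≠ 0 := by exact_mod_cast hH.ne'
  have hgeom (n : ℕ) (hn0 : 0 < n) (hn : n < H) :
      ∑ r ∈ Ioc p (p + H), addE (n * (t - r / H)) = 0 := by
    have h1 : ∑ r ∈ Ioc p (p + H), addE (n * (t - r / H)) =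
        ∑ j ∈ range H, addE (n * (t - (p + 1 : ℤ) / H)) * addE (-(n / H)) ^ j := by
      symm
      refine sum_bij (fun j _ => p + 1 + j) ?_ ?_ ?_ ?_
      · intro j hj
        simp only [mem_range, mem_Ioc] at *
        omega
      · intro i _ j _ h
        simpa using h
      · intro r hr
        rw [mem_Ioc] at hr
        exact ⟨(r - p - 1).toNat, by rw [mem_range]; omega, by omega⟩
      · intro j _
        rw [← addE_nat_mul, ← addE_add]
        push_cast
        congr 1
        field_simp
        ring
    rw [h1, ← mul_sum]
    have hne : addE (-(n / H)) - 1 ≠ 0 := by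
      intro h
      rw [sub_eq_zero, addE, Complex.exp_eq_one_iff] at h
      obtain ⟨k, hk⟩ := h
      have h2 : ((-(n / H) : ℝ) : ℂ) = k := by
        have h3 : (2 * Real.pi * Complex.I : ℂ) ≠ 0 := Complex.two_pi_I_ne_zero
        apply mul_right_cancel₀ h3
        rw [← hk]
        push_cast
        ring
      have h4 : (-(n / H) : ℝ) = k := by exact_mod_cast h2
      have h5 : (n : ℝ) / H < 1 := by
        rw [div_lt_one (by positivity)]
        exact_mod_cast hn
      have h6 : (0 : ℝ) < n / H := by positivity
      have h7 : (-1 : ℝ) < k := by linarith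
      have h8 : (k : ℝ) < 0 := by linarith
      have h9 : (-1 : ℤ) < k := by exact_mod_cast h7
      have h10 : k < 0 := by exact_mod_cast h8
      omega
    have h2 := mul_geom_sum (addE (-(n / H))) H
    rw [← addE_nat_mul, show (H : ℝ) * (-(n / H)) = ((-n : ℤ) : ℝ) by push_cast; field_simp,
      addE_intCast, sub_self] at h2
    rw [(mul_eq_zero.1 h2).resolve_left hne, mul_zero]
  have hexp := sum_norm_sq_expand (Ioc p (p + H)) H (fun r h => addE (h * (t - r / H)))
  have hval : ∀ j ∈ range H, ∀ i ∈ range H,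
      ∑ r ∈ Ioc p (p + H), addE (j * (t - r / H)) * (starRingEnd ℂ) (addE (i * (t - r / H))) =
        if i = j then (H : ℂ) else 0 := by
    intro j hj i hi
    rw [mem_range] at hi hj
    rcases lt_trichotomy i j with h | h | h
    · rw [if_neg h.ne, ← hgeom (j - i) (by omega) (by omega)]
      exact sum_congr rfl fun r _ => addE_mul_conj_nat _ _ h.le _
    · rw [if_pos h, h]
      simp only [addE_mul_conj_nat _ _ le_rfl, Nat.sub_self, Nat.cast_zero, zero_mul, addE_zero]
      simp
    · rw [if_neg h.ne', ← (starRingEnd ℂ).injective.eq_iff, map_zero, map_sum,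
        ← hgeom (i - j) (by omega) (by omega)]
      refine sum_congr rfl fun r _ => ?_
      rw [map_mul, Complex.conj_conj, mul_comm, addE_mul_conj_nat _ _ h.le]
  rw [sum_congr rfl fun j hj => sum_congr rfl fun i hi => hval j hj i hi] at hexp
  have h2 : ∑ j ∈ range H, ∑ i ∈ range H, (if i = j then (H : ℂ) else 0) = ((H : ℝ) ^ 2 : ℝ) := by
    rw [sum_congr rfl fun j hj => by rw [sum_ite_eq' (range H) j, if_pos hj]]
    simp
    ring
  rw [h2, Complex.ofReal_inj] at hexp
  unfold fejer
  rw [← sum_div, hexp, div_self (by positivity)]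

lemma sum_fejer_le {ι : Type*} (s : Finset ι) (u : ι → ℝ) (H : ℕ) (hH : 0 < H) (E : ℝ)
    (hE0 : 0 ≤ E) (hE : ∀ h : ℕ, 1 ≤ h → h < H → ‖∑ k ∈ s, addE (h * u k)‖ ≤ E) (v : ℝ) :
    ∑ k ∈ s, fejer H (u k - v) ≤ #s / H + E := by
  have hH0 : (0 : ℝ) < H := by exact_mod_cast hH
  unfold fejer
  rw [← sum_div, div_le_iff₀ (by positivity)]
  refine (sum_norm_sq_le s H (fun k h => addE (h * (u k - v))) #s E hE0 ?_ ?_).trans (le_of_eq ?_)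
  · intro j _
    simp only [addE_mul_conj_nat _ _ le_rfl, Nat.sub_self, Nat.cast_zero, zero_mul, addE_zero]
    simp
  · intro j hj i hij
    have h1 : ∑ k ∈ s, addE (j * (u k - v)) * (starRingEnd ℂ) (addE (i * (u k - v))) =
        (∑ k ∈ s, addE ((j - i : ℕ) * u k)) * addE (-((j - i : ℕ) * v)) := by
      rw [sum_mul]
      refine sum_congr rfl fun k _ => ?_
      rw [addE_mul_conj_nat _ _ hij.le, ← addE_add]
      ring_nf
    rw [h1, norm_mul, norm_addE, mul_one]
    exact hE _ (by omega) (by omega)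
  · field_simp

/-- Upper bound for the number of points in an interval in terms of exponential sums. -/
lemma card_filter_le_of_addE {ι : Type*} (s : Finset ι) (u : ι → ℝ) (w : ℕ) (hw : 0 < w) (E : ℝ)
    (hE0 : 0 ≤ E) (hE : ∀ h : ℕ, 1 ≤ h → h < w ^ 4 → ‖∑ k ∈ s, addE (h * u k)‖ ≤ E) (α β : ℝ)
    (hαβ : α ≤ β) (hβα : β - α ≤ 1) :
    (#{k ∈ s | α ≤ u k ∧ u k < β} : ℝ) ≤ #s * (β - α) + 6 * #s / w + 6 * (w : ℝ) ^ 4 * E := by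
  have hw1 : (1 : ℝ) ≤ w := by exact_mod_cast hw
  have hw0 : (0 : ℝ) < w := by linarith
  set H := w ^ 4 with hHdef
  have hH : 0 < H := by positivity
  have hHw : (H : ℝ) = (w : ℝ) ^ 4 := by rw [hHdef]; push_cast; rfl
  have hH0 : (0 : ℝ) < H := by exact_mod_cast hH
  set R := Icc ⌊α * H - w ^ 3⌋ ⌈β * H + w ^ 3⌉ with hR
  have hpt (t : ℝ) (ht1 : α ≤ t) (ht2 : t < β) :
      1 - 1 / (4 * (w : ℝ) ^ 2) ≤ ∑ r ∈ R, fejer H (t - r / H) := by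
    set p : ℤ := ⌈t * H - H / 2⌉ - 1 with hp
    have hsum := sum_fejer_eq_one H hH t p
    set Wd := Ioc p (p + H) with hWd
    rw [← sum_filter_add_sum_filter_not Wd (fun r => r ∈ R)] at hsum
    have h1 : ∑ r ∈ Wd with r ∈ R, fejer H (t - r / H) ≤ ∑ r ∈ R, fejer H (t - r / H) :=
      sum_le_sum_of_subset_of_nonneg (fun r hr => (mem_filter.1 hr).2)
        fun _ _ _ => fejer_nonneg _ _
    have h2 : ∑ r ∈ Wd with r ∉ R, fejer H (t - r / H) ≤
        #{r ∈ Wd | r ∉ R} • (1 / (4 * ((w : ℝ) ^ 3) ^ 2)) := by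
      refine sum_le_card_nsmul _ _ _ fun r hr => ?_
      rw [mem_filter, hWd, mem_Ioc, hR, mem_Icc] at hr
      have ht : (t - r / H) * H = t * H - r := by field_simp
      have hr1 : t * H - H / 2 ≤ r := by
        refine (Int.le_ceil _).trans ?_
        exact_mod_cast (by omega : ⌈t * H - H / 2⌉ ≤ r)
      have hr2 : (r : ℝ) ≤ t * H + H / 2 := by
        have h3 := Int.ceil_lt_add_one (t * H - H / 2)
        have h4 : (r : ℝ) ≤ ⌈t * H - H / 2⌉ - 1 + H := by exact_mod_cast hr.1.2
        linarith
      refine fejer_le H (by positivity) ?_ ?_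
      · rw [ht, abs_le]
        constructor <;> linarith
      · rw [ht]
        have hαt : α * H ≤ t * H := by gcongr
        have hβt : t * H ≤ β * H := by gcongr
        rcases not_and_or.1 hr.2 with h | h
        · have h3 : r < ⌊α * H - w ^ 3⌋ := not_le.1 h
          have h4 : (r : ℝ) < α * H - w ^ 3 :=
            lt_of_lt_of_le (by exact_mod_cast h3) (Int.floor_le _)
          exact le_trans (by linarith) (le_abs_self _)
        · have h3 : ⌈β * H + w ^ 3⌉ < r := not_le.1 h
          have h4 : β * H + w ^ 3 < (r : ℝ) :=
            lt_of_le_of_lt (Int.le_ceil _) (by exact_mod_cast h3)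
          exact le_trans (by linarith) (neg_le_abs _)
    have h3 : (#{r ∈ Wd | r ∉ R} : ℝ) ≤ H := by
      have : #{r ∈ Wd | r ∉ R} ≤ #Wd := card_filter_le _ _
      have h4 : #Wd = H := by rw [hWd, Int.card_Ioc]; omega
      rw [h4] at this
      exact_mod_cast this
    have h4 : #{r ∈ Wd | r ∉ R} • (1 / (4 * ((w : ℝ) ^ 3) ^ 2)) ≤ 1 / (4 * (w : ℝ) ^ 2) := by
      rw [nsmul_eq_mul]
      calc _ ≤ (H : ℝ) * (1 / (4 * ((w : ℝ) ^ 3) ^ 2)) := by gcongr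
        _ = _ := by rw [hHw]; field_simp
    linarith
  set S := {k ∈ s | α ≤ u k ∧ u k < β} with hS
  have hSs : (#S : ℝ) ≤ #s := by exact_mod_cast card_filter_le _ _
  have h1 : (#S : ℝ) * (1 - 1 / (4 * (w : ℝ) ^ 2)) ≤ #R * (#s / H + E) := by
    calc (#S : ℝ) * (1 - 1 / (4 * (w : ℝ) ^ 2)) = ∑ k ∈ S, (1 - 1 / (4 * (w : ℝ) ^ 2)) := by
          rw [sum_const, nsmul_eq_mul]
      _ ≤ ∑ k ∈ S, ∑ r ∈ R, fejer H (u k - r / H) := by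
          refine sum_le_sum fun k hk => ?_
          rw [hS, mem_filter] at hk
          exact hpt _ hk.2.1 hk.2.2
      _ ≤ ∑ k ∈ s, ∑ r ∈ R, fejer H (u k - r / H) :=
          sum_le_sum_of_subset_of_nonneg (filter_subset _ _)
            fun _ _ _ => sum_nonneg fun _ _ => fejer_nonneg _ _
      _ = ∑ r ∈ R, ∑ k ∈ s, fejer H (u k - r / H) := sum_comm
      _ ≤ ∑ r ∈ R, ((#s : ℝ) / H + E) :=
          sum_le_sum fun r _ => sum_fejer_le s u H hH E hE0 hE _
      _ = _ := by rw [sum_const, nsmul_eq_mul]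
  have hRc : (#R : ℝ) ≤ (β - α) * H + 2 * w ^ 3 + 3 := by
    have e1 := Int.lt_floor_add_one (α * H - w ^ 3)
    have e2 := Int.ceil_lt_add_one (β * H + w ^ 3)
    have e3 : α * H ≤ β * H := by gcongr
    have e4 : (0 : ℝ) < (w : ℝ) ^ 3 := by positivity
    rw [hR, Int.card_Icc, ← Int.cast_natCast, Int.toNat_of_nonneg]
    · push_cast
      linarith
    · have : (⌊α * H - w ^ 3⌋ : ℝ) ≤ ⌈β * H + w ^ 3⌉ := by
        have := Int.floor_le (α * H - w ^ 3)
        have := Int.le_ceil (β * H + w ^ 3)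
        linarith
      have : ⌊α * H - w ^ 3⌋ ≤ ⌈β * H + w ^ 3⌉ := by exact_mod_cast this
      omega
  have hs0 : (0 : ℝ) ≤ #s := Nat.cast_nonneg _
  have h2 : (#R : ℝ) * (#s / H + E) ≤ ((β - α) * H + 2 * w ^ 3 + 3) * (#s / H + E) := by
    gcongr
  have h3 : ((β - α) * H + 2 * w ^ 3 + 3) * (#s / H + E) =
      #s * (β - α) + (2 * #s / w + 3 * #s / w ^ 4) + ((β - α) * w ^ 4 + 2 * w ^ 3 + 3) * E := by
    rw [hHw]
    field_simp
    ring
  have hw4 : (w : ℝ) ≤ (w : ℝ) ^ 4 := le_self_pow₀ hw1 (by norm_num)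
  have h4 : 3 * (#s : ℝ) / w ^ 4 ≤ 3 * #s / w := by gcongr
  have h5 : ((β - α) * (w : ℝ) ^ 4 + 2 * w ^ 3 + 3) * E ≤ (6 * (w : ℝ) ^ 4) * E := by
    have e1 : (w : ℝ) ^ 3 ≤ (w : ℝ) ^ 4 := pow_le_pow_right₀ hw1 (by norm_num)
    have e2 : (β - α) * (w : ℝ) ^ 4 ≤ 1 * (w : ℝ) ^ 4 := by gcongr
    gcongr
    linarith
  have h6 : (#S : ℝ) * (1 / (4 * (w : ℝ) ^ 2)) ≤ #s / w := by
    calc (#S : ℝ) * (1 / (4 * (w : ℝ) ^ 2)) ≤ #s * (1 / w) := by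
          gcongr
          nlinarith
      _ = _ := by ring
  have h7 : (6 * #s / w : ℝ) = 2 * #s / w + 3 * #s / w + #s / w := by ring
  linarith

lemma dvd_natFloor_iff {x : ℝ} (hx : 0 ≤ x) {d : ℕ} (hd : 0 < d) :
    d ∣ ⌊x⌋₊ ↔ Int.fract (x / d) < 1 / d := by
  have hd0 : (0 : ℝ) < d := by exact_mod_cast hd
  have h1 : Int.fract (x / d) = x / d - (⌊x⌋₊ / d : ℕ) := by
    rw [Int.fract, ← Nat.floor_div_natCast, natCast_floor_eq_intCast_floor (by positivity)]
  rw [h1, sub_lt_iff_lt_add, div_lt_iff₀ hd0, add_mul, one_div, inv_mul_cancel₀ hd0.ne']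
  have h2 := Nat.div_add_mod ⌊x⌋₊ d
  rw [Nat.dvd_iff_mod_eq_zero]
  constructor
  · intro h
    rw [h, add_zero] at h2
    have h3 := Nat.lt_floor_add_one x
    rw [← h2] at h3
    push_cast at h3
    linarith
  · intro h
    have h4 : ⌊x⌋₊ < 1 + ⌊x⌋₊ / d * d := by
      rw [Nat.floor_lt hx]
      push_cast
      exact h
    rw [mul_comm] at h4
    omega

lemma addE_nat_mul_fract (h : ℕ) (x : ℝ) : addE (h * Int.fract x) = addE (h * x) := by
  have h1 : (h : ℝ) * x = h * Int.fract x + ((h * ⌊x⌋ : ℤ) : ℝ) := by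
    push_cast
    rw [← mul_add, Int.fract_add_floor]
  rw [h1, addE_add, addE_intCast, mul_one]

/-- Divisibility of `⌊v k⌋₊` by `d` in terms of exponential sums. -/
lemma abs_card_dvd_natFloor_sub_le {ι : Type*} (s : Finset ι) (v : ι → ℝ)
    (hv : ∀ k ∈ s, 0 ≤ v k) (d : ℕ) (hd : 0 < d) (w : ℕ) (hw : 0 < w) (E : ℝ) (hE0 : 0 ≤ E)
    (hE : ∀ h : ℕ, 1 ≤ h → h < w ^ 4 → ‖∑ k ∈ s, addE (h / d * v k)‖ ≤ E) :
    |(#{k ∈ s | d ∣ ⌊v k⌋₊} : ℝ) - #s / d| ≤ 6 * #s / w + 6 * (w : ℝ) ^ 4 * E := by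
  have hd1 : (1 : ℝ) ≤ d := by exact_mod_cast hd
  have hdinv : 1 / (d : ℝ) ≤ 1 := by rw [div_le_one (by linarith)]; exact hd1
  have hdinv0 : 0 < 1 / (d : ℝ) := by positivity
  have hE' : ∀ h : ℕ, 1 ≤ h → h < w ^ 4 →
      ‖∑ k ∈ s, addE (h * Int.fract (v k / d))‖ ≤ E := by
    intro h h1 h2
    simp only [addE_nat_mul_fract]
    convert hE h h1 h2 using 4 with k
    ring
  have h1 := card_filter_le_of_addE s (fun k => Int.fract (v k / d)) w hw E hE0 hE' 0 (1 / d)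
    hdinv0.le (by linarith)
  have h2 := card_filter_le_of_addE s (fun k => Int.fract (v k / d)) w hw E hE0 hE' (1 / d) 1
    hdinv (by linarith)
  have e1 : {k ∈ s | 0 ≤ Int.fract (v k / d) ∧ Int.fract (v k / d) < 1 / d} =
      {k ∈ s | d ∣ ⌊v k⌋₊} := by
    refine filter_congr fun k hk => ?_
    rw [dvd_natFloor_iff (hv k hk) hd]
    exact ⟨fun h => h.2, fun h => ⟨Int.fract_nonneg _, h⟩⟩
  have e2 : {k ∈ s | 1 / (d : ℝ) ≤ Int.fract (v k / d) ∧ Int.fract (v k / d) < 1} =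
      {k ∈ s | ¬ d ∣ ⌊v k⌋₊} := by
    refine filter_congr fun k hk => ?_
    rw [dvd_natFloor_iff (hv k hk) hd, not_lt]
    exact ⟨fun h => h.1, fun h => ⟨h, Int.fract_lt_one _⟩⟩
  rw [e1] at h1
  rw [e2] at h2
  have h3 : (#{k ∈ s | d ∣ ⌊v k⌋₊} : ℝ) + #{k ∈ s | ¬ d ∣ ⌊v k⌋₊} = #s := by
    exact_mod_cast card_filter_add_card_filter_not (s := s) fun k => d ∣ ⌊v k⌋₊
  rw [sub_zero, mul_one_div] at h1
  rw [mul_sub, mul_one_div, mul_one] at h2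
  rw [abs_le]
  constructor <;> linarith

/-- Equidistribution of `⌊k ^ c⌋` in the residue class `0` modulo `d`, with a power saving. -/
theorem exists_abs_card_dvd_floor_rpow_sub_le (c : ℝ) (hc : 1 < c) (hcne : ∀ n : ℤ, c ≠ n) :
    ∃ δ : ℝ, 0 < δ ∧ δ ≤ 1 / 4 ∧ ∀ᶠ T : ℝ in atTop, ∀ d : ℕ, 1 ≤ d → (d : ℝ) ≤ T ^ δ →
      ∀ a b : ℤ, T ^ (1 - δ) ≤ a → (b : ℝ) ≤ T → a ≤ b →
        |(#{k ∈ Ioc a b | d ∣ ⌊((k : ℤ) : ℝ) ^ c⌋₊} : ℝ) - (b - a) / d| ≤ 84 * T ^ (1 - 2 * δ) := by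
  obtain ⟨η, hη0, hη1, β, hβ0, hβ1, hexp⟩ := exists_norm_sum_addE_rpow_le c hc hcne
  set δ : ℝ := η * β / 10 with hδ
  have hδ0 : 0 < δ := by positivity
  have hηβ : η * β = 10 * δ := by rw [hδ]; ring
  have hδη : 10 * δ ≤ η := by nlinarith
  refine ⟨δ, hδ0, by linarith, ?_⟩
  have t1 := (tendsto_rpow_atTop hδ0).eventually_ge_atTop 2
  filter_upwards [hexp, t1, eventually_ge_atTop 1] with T hexp t1 hT1 d hd1 hdT a b ha hb hab
  have hT0 : 0 < T := by linarith
  have half_floor (z : ℝ) (hz : 2 ≤ z) : z / 2 ≤ ⌊z⌋₊ := by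
    have := Nat.lt_floor_add_one z
    linarith
  have hTη : 2 ≤ T ^ η := t1.trans (Real.rpow_le_rpow_of_exponent_le hT1 (by linarith))
  have hTδ : 2 ≤ T ^ (2 * δ) := t1.trans (Real.rpow_le_rpow_of_exponent_le hT1 (by linarith))
  set P := ⌊T ^ η⌋₊ with hP
  set w := ⌊T ^ (2 * δ)⌋₊ with hw
  have hP2 := half_floor _ hTη
  have hw2 := half_floor _ hTδ
  rw [← hP] at hP2
  rw [← hw] at hw2
  have hPT : (P : ℝ) ≤ T ^ η := Nat.floor_le (by positivity)
  have hwT : (w : ℝ) ≤ T ^ (2 * δ) := Nat.floor_le (by positivity)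
  have hP1 : 1 ≤ P := Nat.one_le_cast.1 (by linarith : (1 : ℝ) ≤ P)
  have hw1 : 1 ≤ w := Nat.one_le_cast.1 (by linarith : (1 : ℝ) ≤ w)
  have hP0 : (0 : ℝ) < P := by exact_mod_cast hP1
  have hw0 : (0 : ℝ) < w := by exact_mod_cast hw1
  have hd0 : (0 : ℝ) < d := by exact_mod_cast hd1
  have hdP : d ≤ P :=
    Nat.le_floor (hdT.trans (Real.rpow_le_rpow_of_exponent_le hT1 (by linarith)))
  have hw4T : (w : ℝ) ^ 4 ≤ T ^ (8 * δ) := by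
    calc (w : ℝ) ^ 4 ≤ (T ^ (2 * δ)) ^ 4 := by gcongr
      _ = T ^ (8 * δ) := by
        rw [← Real.rpow_natCast, ← Real.rpow_mul hT0.le]
        norm_num
        ring_nf
  have hw4P : w ^ 4 ≤ P := Nat.le_floor (by
    push_cast
    exact hw4T.trans (Real.rpow_le_rpow_of_exponent_le hT1 (by linarith)))
  have hTPa : T / P ≤ a := by
    refine le_trans ?_ ha
    rw [div_le_iff₀ hP0]
    calc T = T ^ (1 - δ) * T ^ δ := by rw [← Real.rpow_add hT0]; norm_num
      _ ≤ T ^ (1 - δ) * P := by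
        gcongr
        have : T ^ δ * 2 ≤ T ^ η := by
          calc T ^ δ * 2 ≤ T ^ δ * T ^ δ := by gcongr
            _ = T ^ (δ + δ) := (Real.rpow_add hT0 _ _).symm
            _ ≤ T ^ η := Real.rpow_le_rpow_of_exponent_le hT1 (by linarith)
        linarith
  set E : ℝ := 6 * T * (P : ℝ) ^ (-β) with hE
  have hcard : (#(Ioc a b) : ℝ) = b - a := by
    rw [Int.card_Ioc, ← Int.cast_natCast, Int.toNat_of_nonneg (by omega)]
    push_cast
    ring
  have ha0 : (0 : ℝ) < a := lt_of_lt_of_le (by positivity) hTPa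
  have hcardT : (#(Ioc a b) : ℝ) ≤ T := by linarith
  have h := abs_card_dvd_natFloor_sub_le (Ioc a b) (fun k => (k : ℝ) ^ c) (by
      intro k hk
      rw [mem_Ioc] at hk
      have : (a : ℝ) < k := by exact_mod_cast hk.1
      exact Real.rpow_nonneg (by linarith) _) d hd1 w hw1 E (by positivity) (by
      intro m hm1 hmw
      refine hexp P hP1 hPT (m / d) ?_ ?_ a b hTPa hb
      · have : (1 : ℝ) ≤ m := by exact_mod_cast hm1
        gcongr
      · rw [div_le_iff₀ hd0]
        have h1 : (m : ℝ) ≤ P := by exact_mod_cast hmw.le.trans hw4P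
        have h2 : (1 : ℝ) ≤ d := by exact_mod_cast hd1
        nlinarith)
  rw [hcard] at h
  refine h.trans ?_
  rw [← hcard]
  have hTw : 6 * (#(Ioc a b) : ℝ) / w ≤ 12 * T ^ (1 - 2 * δ) := by
    rw [div_le_iff₀ hw0]
    calc 6 * (#(Ioc a b) : ℝ) ≤ 6 * T := by gcongr
      _ = 12 * (T ^ (1 - 2 * δ) * (T ^ (2 * δ) / 2)) := by
        rw [mul_div_assoc', ← Real.rpow_add hT0]
        norm_num
        ring
      _ ≤ 12 * (T ^ (1 - 2 * δ) * w) := by gcongr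
      _ = _ := by ring
  have hPβ : (P : ℝ) ^ (-β) ≤ 2 * T ^ (-(10 * δ)) := by
    calc (P : ℝ) ^ (-β) ≤ (T ^ η / 2) ^ (-β) :=
          Real.rpow_le_rpow_of_nonpos (by positivity) hP2 (by linarith)
      _ = (2 : ℝ) ^ β * T ^ (-(10 * δ)) := by
        rw [Real.div_rpow (by positivity) (by norm_num), ← Real.rpow_mul hT0.le,
          Real.rpow_neg (by norm_num : (0 : ℝ) ≤ 2), div_inv_eq_mul, mul_comm, mul_neg, hηβ]
      _ ≤ (2 : ℝ) ^ (1 : ℝ) * T ^ (-(10 * δ)) := by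
        gcongr
        norm_num
      _ = _ := by rw [Real.rpow_one]
  have hwE : 6 * (w : ℝ) ^ 4 * E ≤ 72 * T ^ (1 - 2 * δ) := by
    calc 6 * (w : ℝ) ^ 4 * E ≤ 6 * T ^ (8 * δ) * (6 * T * (2 * T ^ (-(10 * δ)))) := by
          rw [hE]
          gcongr
      _ = 72 * (T ^ (8 * δ) * T ^ (1 : ℝ) * T ^ (-(10 * δ))) := by rw [Real.rpow_one]; ring
      _ = _ := by
        rw [← Real.rpow_add hT0, ← Real.rpow_add hT0]
        ring_nf
  linarith

/-- The multiplicative weight `μ(n)² / φ(n)`. -/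
noncomputable def sqfreeWeight (n : ℕ) : ℝ :=
  (ArithmeticFunction.moebius n : ℝ) ^ 2 / (Nat.totient n : ℝ)

lemma moebius_sq_cast (n : ℕ) :
    (ArithmeticFunction.moebius n : ℝ) ^ 2 = if Squarefree n then 1 else 0 := by
  have h := ArithmeticFunction.moebius_sq (n := n)
  exact_mod_cast congrArg (Int.cast : ℤ → ℝ) h

lemma sqfreeWeight_nonneg (n : ℕ) : 0 ≤ sqfreeWeight n := by unfold sqfreeWeight; positivity

lemma sqfreeWeight_le_one (n : ℕ) : sqfreeWeight n ≤ 1 := by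
  unfold sqfreeWeight
  rcases Nat.eq_zero_or_pos n with h | h
  · simp [h]
  · have h1 : (1 : ℝ) ≤ Nat.totient n := by exact_mod_cast Nat.totient_pos.2 h
    rw [div_le_one (by linarith), moebius_sq_cast]
    split_ifs <;> linarith

lemma sum_divisors_squarefree (n : ℕ) (hn : n ≠ 0) (f : ℕ → ℝ) :
    ∑ d ∈ n.divisors, (if Squarefree d then f d else 0) =
      ∑ t ∈ n.primeFactors.powerset, f (∏ p ∈ t, p) := by
  rw [← sum_filter, Nat.sum_divisors_filter_squarefree hn]
  have h : (UniqueFactorizationMonoid.normalizedFactors n).toFinset = n.primeFactors := by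
    rw [Nat.factors_eq]
    rfl
  rw [h]
  refine sum_congr rfl fun t _ => ?_
  rw [prod_val]
  rfl

lemma sum_divisors_moebius_sq (n : ℕ) (hn : n ≠ 0) :
    ∑ d ∈ n.divisors, (ArithmeticFunction.moebius d : ℝ) ^ 2 = 2 ^ #n.primeFactors := by
  simp only [moebius_sq_cast]
  rw [sum_divisors_squarefree n hn fun _ => 1]
  simp

lemma totient_prod_primes (t : Finset ℕ) (ht : ∀ p ∈ t, p.Prime) :
    Nat.totient (∏ p ∈ t, p) = ∏ p ∈ t, (p - 1) := by
  classical
  induction t using Finset.induction_on with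
  | empty => simp
  | insert p t hp ih =>
    rw [prod_insert hp, prod_insert hp, Nat.totient_mul, ih fun q hq => ht q (mem_insert_of_mem hq),
      Nat.totient_prime (ht p (mem_insert_self _ _))]
    refine Nat.Coprime.prod_right fun q hq => ?_
    rw [Nat.coprime_primes (ht p (mem_insert_self _ _)) (ht q (mem_insert_of_mem hq))]
    rintro rfl
    exact hp hq

lemma div_totient_eq_sum (n : ℕ) (hn : n ≠ 0) :
    (n : ℝ) / Nat.totient n = ∑ d ∈ n.divisors, sqfreeWeight d := by
  have h1 : ∑ d ∈ n.divisors, sqfreeWeight d =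
      ∑ t ∈ n.primeFactors.powerset, 1 / (Nat.totient (∏ p ∈ t, p) : ℝ) := by
    rw [← sum_divisors_squarefree n hn fun d => 1 / (Nat.totient d : ℝ)]
    refine sum_congr rfl fun d _ => ?_
    rw [sqfreeWeight, moebius_sq_cast]
    split_ifs <;> simp
  have h2 : ∑ t ∈ n.primeFactors.powerset, 1 / (Nat.totient (∏ p ∈ t, p) : ℝ) =
      ∑ t ∈ n.primeFactors.powerset, ∏ p ∈ t, 1 / ((p : ℝ) - 1) := by
    refine sum_congr rfl fun t ht => ?_
    rw [mem_powerset] at ht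
    have hp : ∀ p ∈ t, p.Prime := fun p hp => Nat.prime_of_mem_primeFactors (ht hp)
    rw [totient_prod_primes t hp, Nat.cast_prod, prod_div_distrib, prod_const_one]
    congr 1
    refine prod_congr rfl fun p hpt => ?_
    rw [Nat.cast_sub (hp p hpt).one_le, Nat.cast_one]
  have h3 := congrArg (Rat.cast : ℚ → ℝ) (Nat.totient_eq_mul_prod_factors n)
  push_cast at h3
  rw [h1, h2, ← prod_one_add, h3]
  have hn0 : (n : ℝ) ≠ 0 := by exact_mod_cast hn
  have h4 : ∏ p ∈ n.primeFactors, (1 + 1 / ((p : ℝ) - 1)) =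
      (∏ p ∈ n.primeFactors, (1 - (p : ℝ)⁻¹))⁻¹ := by
    rw [← prod_inv_distrib]
    refine prod_congr rfl fun p hp => ?_
    have hp2 : (2 : ℝ) ≤ p := by exact_mod_cast (Nat.prime_of_mem_primeFactors hp).two_le
    have e1 : (p : ℝ) - 1 ≠ 0 := by linarith
    have e2 : (p : ℝ) ≠ 0 := by linarith
    have e3 : 1 - (p : ℝ)⁻¹ = (p - 1) / p := by field_simp
    rw [e3, inv_div]
    field_simp
    ring
  rw [h4, div_mul_eq_div_div, div_self hn0, one_div]

lemma exists_two_pow_card_primeFactors_le (ε : ℝ) (hε : 0 < ε) :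
    ∃ C : ℝ, 1 ≤ C ∧ ∀ n : ℕ, n ≠ 0 → (2 : ℝ) ^ #n.primeFactors ≤ C * (n : ℝ) ^ ε := by
  obtain ⟨K, hK⟩ := exists_nat_ge ((2 : ℝ) ^ (1 / ε))
  refine ⟨2 ^ K, one_le_pow₀ (by norm_num), fun n hn => ?_⟩
  have h1 : (2 : ℝ) ^ #n.primeFactors ≤
      ∏ p ∈ n.primeFactors, ((if p < K then 2 else 1) * (p : ℝ) ^ ε) := by
    rw [← prod_const]
    refine prod_le_prod (fun _ _ => by norm_num) fun p hp => ?_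
    have hp1 : (1 : ℝ) ≤ p := by exact_mod_cast (Nat.prime_of_mem_primeFactors hp).one_le
    split_ifs with h
    · have := Real.one_le_rpow hp1 hε.le
      linarith
    · rw [one_mul]
      have h2 : (2 : ℝ) ^ (1 / ε) ≤ p := hK.trans (by exact_mod_cast not_lt.1 h)
      calc (2 : ℝ) = ((2 : ℝ) ^ (1 / ε)) ^ ε := by
            rw [← Real.rpow_mul (by norm_num), one_div_mul_cancel hε.ne', Real.rpow_one]
        _ ≤ _ := by gcongr
  refine h1.trans ?_
  rw [prod_mul_distrib]
  have h2 : ∏ p ∈ n.primeFactors, (if p < K then (2 : ℝ) else 1) ≤ 2 ^ K := by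
    rw [prod_ite, prod_const, prod_const_one, mul_one]
    refine pow_le_pow_right₀ (by norm_num) ?_
    calc #{p ∈ n.primeFactors | p < K} ≤ #(range K) :=
          card_le_card fun p hp => mem_range.2 (mem_filter.1 hp).2
      _ = K := card_range K
  have h3 : ∏ p ∈ n.primeFactors, (p : ℝ) ^ ε ≤ (n : ℝ) ^ ε := by
    rw [Real.finsetProd_rpow _ _ fun _ _ => Nat.cast_nonneg _]
    refine Real.rpow_le_rpow (prod_nonneg fun _ _ => Nat.cast_nonneg _) ?_ hε.le
    rw [← Nat.cast_prod]
    exact Nat.cast_le.2 (Nat.le_of_dvd (Nat.pos_of_ne_zero hn) (Nat.prod_primeFactors_dvd n))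
  gcongr

lemma div_totient_le_two_pow (n : ℕ) (hn : n ≠ 0) :
    (n : ℝ) / Nat.totient n ≤ 2 ^ #n.primeFactors := by
  rw [div_totient_eq_sum n hn, ← sum_divisors_moebius_sq n hn]
  refine sum_le_sum fun d hd => ?_
  have : (1 : ℝ) ≤ Nat.totient d := by
    exact_mod_cast Nat.totient_pos.2 (Nat.pos_of_mem_divisors hd)
  exact div_le_self (by positivity) this

/-- `sqfreeWeight` decays like `n ^ (-1/2)` at least. -/
lemma exists_sqfreeWeight_le :
    ∃ C : ℝ, 1 ≤ C ∧ ∀ n : ℕ, n ≠ 0 →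
      sqfreeWeight n ≤ C * (ArithmeticFunction.moebius n : ℝ) ^ 2 * (n : ℝ) ^ (-(1 / 2 : ℝ)) := by
  obtain ⟨C, hC, h⟩ := exists_two_pow_card_primeFactors_le (1 / 2) (by norm_num)
  refine ⟨C, hC, fun n hn => ?_⟩
  have hn0 : (0 : ℝ) < n := by exact_mod_cast Nat.pos_of_ne_zero hn
  have h1 := (div_totient_le_two_pow n hn).trans (h n hn)
  have h2 : 1 / (Nat.totient n : ℝ) ≤ C * (n : ℝ) ^ (-(1 / 2 : ℝ)) := by
    have h3 : (n : ℝ) ^ (1 / 2 : ℝ) = n * (n : ℝ) ^ (-(1 / 2 : ℝ)) := by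
      nth_rewrite 2 [← Real.rpow_one (n : ℝ)]
      rw [← Real.rpow_add hn0]
      norm_num
    rw [h3, div_eq_mul_one_div] at h1
    refine le_of_mul_le_mul_left (h1.trans (le_of_eq ?_)) hn0
    ring
  rw [sqfreeWeight, div_eq_mul_one_div]
  calc _ ≤ (ArithmeticFunction.moebius n : ℝ) ^ 2 * (C * (n : ℝ) ^ (-(1 / 2 : ℝ))) := by gcongr
    _ = _ := by ring

/-- The contribution of large divisors to `n / φ(n)`. -/
lemma exists_abs_div_totient_sub_sum_le (ε : ℝ) (hε : 0 < ε) :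
    ∃ C : ℝ, 1 ≤ C ∧ ∀ n : ℕ, n ≠ 0 → ∀ D : ℕ,
      |(n : ℝ) / Nat.totient n - ∑ d ∈ Icc 1 D, (if d ∣ n then sqfreeWeight d else 0)| ≤
        C * (n : ℝ) ^ ε * ((D : ℝ) + 1) ^ (-(1 / 2 : ℝ)) := by
  obtain ⟨C₁, hC₁, h₁⟩ := exists_two_pow_card_primeFactors_le ε hε
  obtain ⟨C₂, hC₂, h₂⟩ := exists_sqfreeWeight_le
  refine ⟨C₂ * C₁, by nlinarith, fun n hn D => ?_⟩
  have h3 : ∑ d ∈ Icc 1 D, (if d ∣ n then sqfreeWeight d else 0) =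
      ∑ d ∈ n.divisors with d ≤ D, sqfreeWeight d := by
    rw [← sum_filter]
    refine sum_congr ?_ fun _ _ => rfl
    ext d
    simp only [mem_filter, mem_Icc, Nat.mem_divisors]
    refine ⟨fun h => ⟨⟨h.2, hn⟩, h.1.2⟩, fun h => ⟨⟨?_, h.2⟩, h.1.1⟩⟩
    exact Nat.pos_of_dvd_of_pos h.1.1 (Nat.pos_of_ne_zero hn)
  rw [h3, div_totient_eq_sum n hn, ← sum_filter_add_sum_filter_not n.divisors (fun d => d ≤ D),
    add_sub_cancel_left, abs_of_nonneg (sum_nonneg fun _ _ => sqfreeWeight_nonneg _)]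
  calc ∑ d ∈ n.divisors with ¬ d ≤ D, sqfreeWeight d
      ≤ ∑ d ∈ n.divisors with ¬ d ≤ D, C₂ * (ArithmeticFunction.moebius d : ℝ) ^ 2 *
          ((D : ℝ) + 1) ^ (-(1 / 2 : ℝ)) := by
        refine sum_le_sum fun d hd => ?_
        rw [mem_filter] at hd
        refine (h₂ d (Nat.pos_of_mem_divisors hd.1).ne').trans ?_
        refine mul_le_mul_of_nonneg_left
          (Real.rpow_le_rpow_of_nonpos (by positivity) ?_ (by norm_num)) (by positivity)
        exact_mod_cast not_le.1 hd.2
    _ ≤ ∑ d ∈ n.divisors, C₂ * (ArithmeticFunction.moebius d : ℝ) ^ 2 *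
          ((D : ℝ) + 1) ^ (-(1 / 2 : ℝ)) :=
        sum_le_sum_of_subset_of_nonneg (filter_subset _ _) fun _ _ _ => by positivity
    _ = C₂ * 2 ^ #n.primeFactors * ((D : ℝ) + 1) ^ (-(1 / 2 : ℝ)) := by
        rw [← sum_mul, ← mul_sum, sum_divisors_moebius_sq n hn]
    _ ≤ C₂ * (C₁ * (n : ℝ) ^ ε) * ((D : ℝ) + 1) ^ (-(1 / 2 : ℝ)) := by
        gcongr
        exact h₁ n hn
    _ = _ := by ring

lemma exists_div_totient_le (ε : ℝ) (hε : 0 < ε) :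
    ∃ C : ℝ, 1 ≤ C ∧ ∀ n : ℕ, n ≠ 0 → (n : ℝ) / Nat.totient n ≤ C * (n : ℝ) ^ ε := by
  obtain ⟨C, hC, h⟩ := exists_two_pow_card_primeFactors_le ε hε
  exact ⟨C, hC, fun n hn => (div_totient_le_two_pow n hn).trans (h n hn)⟩

/-- Rate of convergence of the series `∑ μ(n)² / (n φ(n))`. -/
lemma exists_abs_tsum_sub_sum_le :
    ∃ C : ℝ, 1 ≤ C ∧ ∀ D : ℕ,
      |frakc - ∑ d ∈ Icc 1 D, sqfreeWeight d / d| ≤ C * ((D : ℝ) + 1) ^ (-(1 / 4 : ℝ)) := by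
  obtain ⟨C, hC, h⟩ := exists_sqfreeWeight_le
  have hsum : Summable fun n : ℕ => (n : ℝ) ^ (-(5 / 4) : ℝ) :=
    Real.summable_nat_rpow.2 (by norm_num)
  set a : ℕ → ℝ := fun n =>
    (ArithmeticFunction.moebius n : ℝ) ^ 2 / ((n : ℝ) * (Nat.totient n : ℝ)) with ha
  have haw (n : ℕ) : a n = sqfreeWeight n / n := by
    rw [ha, sqfreeWeight, div_div, mul_comm]
  have ha0 (n : ℕ) : 0 ≤ a n := by rw [haw]; have := sqfreeWeight_nonneg n; positivity
  have hale (n : ℕ) (hn : n ≠ 0) : a n ≤ C * (n : ℝ) ^ (-(3 / 2) : ℝ) := by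
    have hn0 : (0 : ℝ) < n := by exact_mod_cast Nat.pos_of_ne_zero hn
    rw [haw, div_le_iff₀ hn0]
    refine (h n hn).trans ?_
    have h1 : (n : ℝ) ^ (-(3 / 2) : ℝ) * n = (n : ℝ) ^ (-(1 / 2) : ℝ) := by
      nth_rewrite 2 [← Real.rpow_one (n : ℝ)]
      rw [← Real.rpow_add hn0]
      norm_num
    rw [mul_assoc C ((n : ℝ) ^ _), h1, moebius_sq_cast]
    have : (0 : ℝ) ≤ (n : ℝ) ^ (-(1 / 2) : ℝ) := by positivity
    split_ifs <;> nlinarith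
  have hale2 (n : ℕ) : a n ≤ C * (n : ℝ) ^ (-(5 / 4) : ℝ) := by
    rcases Nat.eq_zero_or_pos n with h0 | h0
    · simp [ha, h0]
    · exact (hale n h0.ne').trans (mul_le_mul_of_nonneg_left
        (Real.rpow_le_rpow_of_exponent_le (by exact_mod_cast h0) (by norm_num)) (by linarith))
  have hsa : Summable a := Summable.of_nonneg_of_le ha0 hale2 (hsum.mul_left C)
  set S := ∑' n : ℕ, (n : ℝ) ^ (-(5 / 4) : ℝ) with hS
  have hS1 : 1 ≤ S := by
    have := hsum.le_tsum 1 fun _ _ => by positivity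
    simpa using this
  refine ⟨C * S, by nlinarith, fun D => ?_⟩
  have hfin : ∑ d ∈ Icc 1 D, sqfreeWeight d / d = ∑ d ∈ range (D + 1), a d := by
    rw [← sum_subset (s₁ := Icc 1 D) (s₂ := range (D + 1)) (f := a)]
    · exact sum_congr rfl fun d _ => (haw d).symm
    · intro d
      simp only [mem_Icc, mem_range]
      omega
    · intro d hd hd'
      simp only [mem_Icc, mem_range] at hd hd'
      have : d = 0 := by omega
      simp [ha, this]
  have htail := hsa.sum_add_tsum_nat_add (D + 1)
  rw [frakc, hfin, ← htail, add_sub_cancel_left,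
    abs_of_nonneg (tsum_nonneg fun n => ha0 _)]
  have hs1 : Summable fun n : ℕ => ((n + (D + 1) : ℕ) : ℝ) ^ (-(5 / 4) : ℝ) :=
    (summable_nat_add_iff (D + 1)).2 hsum
  calc ∑' n : ℕ, a (n + (D + 1))
      ≤ ∑' n : ℕ, C * ((D : ℝ) + 1) ^ (-(1 / 4 : ℝ)) *
          ((n + (D + 1) : ℕ) : ℝ) ^ (-(5 / 4) : ℝ) := by
        refine Summable.tsum_le_tsum (fun n => ?_) ((summable_nat_add_iff (D + 1)).2 hsa)
          (hs1.mul_left _)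
        refine (hale _ (by omega)).trans ?_
        have h0 : (0 : ℝ) < ((n + (D + 1) : ℕ) : ℝ) := by positivity
        rw [show (-(3 / 2) : ℝ) = -(1 / 4) + -(5 / 4) by norm_num, Real.rpow_add h0, mul_assoc]
        refine mul_le_mul_of_nonneg_left (mul_le_mul_of_nonneg_right
          (Real.rpow_le_rpow_of_nonpos (by positivity) ?_ (by norm_num)) (by positivity))
          (by linarith)
        push_cast
        linarith [Nat.cast_nonneg (α := ℝ) n]
    _ = C * ((D : ℝ) + 1) ^ (-(1 / 4 : ℝ)) *
          ∑' n : ℕ, ((n + (D + 1) : ℕ) : ℝ) ^ (-(5 / 4) : ℝ) := tsum_mul_left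
    _ ≤ C * ((D : ℝ) + 1) ^ (-(1 / 4 : ℝ)) * S := by
        gcongr
        have := hsum.sum_add_tsum_nat_add (D + 1)
        rw [hS, ← this]
        have : 0 ≤ ∑ i ∈ range (D + 1), (i : ℝ) ^ (-(5 / 4) : ℝ) := by positivity
        linarith
    _ = _ := by ring

/-- Partial summation against the weight `1 / k`. -/
lemma abs_sum_div_le_of_abs_sum_le (f : ℤ → ℝ) (a b : ℤ) (ha : 0 < a) (hab : a ≤ b) (M : ℝ)
    (hM : ∀ b', a ≤ b' → b' ≤ b → |∑ k ∈ Ioc a b', f k| ≤ M) :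
    |∑ k ∈ Ioc a b, f k / k| ≤ M / a := by
  have key : ∀ b', a ≤ b' → b' ≤ b →
      |∑ k ∈ Ioc a b', f k / k - (∑ k ∈ Ioc a b', f k) / b'| ≤ M * (1 / a - 1 / b') := by
    intro b' hb'
    induction b', hb' using Int.leInduction with
    | base => simp
    | succ m hm ih =>
      intro hmb
      have hm0 : (0 : ℝ) < m := by exact_mod_cast ha.trans_le hm
      have ih' := ih (by omega)
      have hI : Ioc a (m + 1) = insert (m + 1) (Ioc a m) := by
        ext k
        simp only [mem_Ioc, mem_insert]
        omega
      have hn : m + 1 ∉ Ioc a m := by simp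
      have hw : (0 : ℝ) ≤ 1 / m - 1 / (m + 1) :=
        sub_nonneg.2 (one_div_le_one_div_of_le hm0 (by linarith))
      have hS := mul_le_mul_of_nonneg_right (hM m hm (by omega)) hw
      have hx : ∑ k ∈ Ioc a (m + 1), f k / k - (∑ k ∈ Ioc a (m + 1), f k) / ((m + 1 : ℤ) : ℝ) =
          (∑ k ∈ Ioc a m, f k / k - (∑ k ∈ Ioc a m, f k) / m) +
            (∑ k ∈ Ioc a m, f k) * (1 / m - 1 / (m + 1)) := by
        rw [hI, sum_insert hn, sum_insert hn]
        push_cast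
        ring
      rw [hx]
      refine (abs_add_le _ _).trans ?_
      rw [abs_mul, abs_of_nonneg hw]
      push_cast
      linarith
  have hb0 : (0 : ℝ) < b := by exact_mod_cast ha.trans_le hab
  have h1 := key b hab le_rfl
  have h2 : |(∑ k ∈ Ioc a b, f k) / b| ≤ M / b := by
    rw [abs_div, abs_of_pos hb0]
    gcongr
    exact hM b hab le_rfl
  have h3 := abs_add_le (∑ k ∈ Ioc a b, f k / k - (∑ k ∈ Ioc a b, f k) / b)
    ((∑ k ∈ Ioc a b, f k) / b)
  rw [sub_add_cancel] at h3
  have h4 : M * (1 / a - 1 / b) + M / b = M / a := by ring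
  linarith

lemma abs_sum_inv_sub_log_le (a b : ℤ) (ha : 0 < a) (hab : a ≤ b) :
    |∑ k ∈ Ioc a b, 1 / (k : ℝ) - (Real.log b - Real.log a)| ≤ 1 / a := by
  have key : 0 ≤ Real.log b - Real.log a - ∑ k ∈ Ioc a b, 1 / (k : ℝ) ∧
      Real.log b - Real.log a - ∑ k ∈ Ioc a b, 1 / (k : ℝ) ≤ 1 / a - 1 / b := by
    induction b, hab using Int.leInduction with
    | base => simp
    | succ m hm ih =>
      have hm0 : (0 : ℝ) < m := by exact_mod_cast ha.trans_le hm
      have hI : Ioc a (m + 1) = insert (m + 1) (Ioc a m) := by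
        ext k
        simp only [mem_Ioc, mem_insert]
        omega
      have hn : m + 1 ∉ Ioc a m := by simp
      rw [hI, sum_insert hn]
      push_cast
      have h1 : Real.log (m + 1) - Real.log m ≤ 1 / m := by
        rw [← Real.log_div (by linarith) hm0.ne']
        refine (Real.log_le_sub_one_of_pos (by positivity)).trans (le_of_eq ?_)
        field_simp
        ring
      have h2 : Real.log m - Real.log (m + 1) ≤ -(1 / (m + 1)) := by
        rw [← Real.log_div hm0.ne' (by linarith)]
        refine (Real.log_le_sub_one_of_pos (by positivity)).trans (le_of_eq ?_)
        field_simp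
        ring
      constructor <;> linarith [ih.1, ih.2]
  have hb0 : (0 : ℝ) < b := by exact_mod_cast ha.trans_le hab
  have : (0 : ℝ) < 1 / b := by positivity
  have ha0 : (0 : ℝ) < a := by exact_mod_cast ha
  rw [abs_le]
  constructor <;> linarith [key.1, key.2]

lemma abs_log_sub_log_le {u v : ℝ} (hu : 2 ≤ u) (hvu : v ≤ u) (huv : u < v + 1) :
    |Real.log v - Real.log u| ≤ 2 / u := by
  have hv0 : 0 < v := by linarith
  have h1 : Real.log v ≤ Real.log u := Real.log_le_log hv0 hvu
  have h2 : Real.log u - Real.log v ≤ 2 / u := by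
    rw [← Real.log_div (by linarith) hv0.ne']
    refine (Real.log_le_sub_one_of_pos (by positivity)).trans ?_
    rw [div_sub_one hv0.ne', div_le_div_iff₀ hv0 (by linarith)]
    nlinarith
  rw [abs_le]
  constructor <;> linarith [show 0 ≤ 2 / u by positivity]

/-- Comparison of the harmonic sum with the logarithm of the quotient of the floors. -/
lemma abs_mul_sum_inv_sub_log_floor_le (c : ℝ) (hc : 1 < c) (y₁ y : ℝ) (h₁ : 2 ≤ y₁)
    (hy : y₁ < y) :
    |c * ∑ k ∈ Ioc ⌊y₁⌋ ⌊y⌋, 1 / (k : ℝ) -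
        Real.log ((⌊y ^ c⌋₊ : ℝ) / (⌊y₁ ^ c⌋₊ : ℝ))| ≤ 10 * c / y₁ := by
  have hy0 : 0 < y₁ := by linarith
  have hpow {u : ℝ} (hu : 1 ≤ u) : u ≤ u ^ c := by
    simpa using Real.rpow_le_rpow_of_exponent_le hu hc.le
  have hfl {u : ℝ} (hu : y₁ ≤ u) : |Real.log ⌊u ^ c⌋₊ - c * Real.log u| ≤ 2 / y₁ := by
    rw [← Real.log_rpow (by linarith)]
    have h := hpow (u := u) (by linarith)
    refine (abs_log_sub_log_le (by linarith) (Nat.floor_le (by linarith))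
      (Nat.lt_floor_add_one _)).trans ?_
    gcongr
    linarith
  have hil {u : ℝ} (hu : y₁ ≤ u) : |Real.log ⌊u⌋ - Real.log u| ≤ 2 / y₁ := by
    refine (abs_log_sub_log_le (by linarith) (Int.floor_le _) (Int.lt_floor_add_one _)).trans ?_
    gcongr
  have ha : 0 < ⌊y₁⌋ := Int.floor_pos.2 (by linarith)
  have h1 := abs_sum_inv_sub_log_le ⌊y₁⌋ ⌊y⌋ ha (Int.floor_mono hy.le)
  have h2 : 1 / (⌊y₁⌋ : ℝ) ≤ 2 / y₁ := by
    rw [div_le_div_iff₀ (by exact_mod_cast ha) hy0]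
    linarith [Int.lt_floor_add_one y₁]
  have hne {u : ℝ} (hu : y₁ ≤ u) : (⌊u ^ c⌋₊ : ℝ) ≠ 0 := by
    have h := hpow (u := u) (by linarith)
    exact_mod_cast (Nat.floor_pos.2 (by linarith)).ne'
  rw [Real.log_div (hne hy.le) (hne le_rfl)]
  have e1 := abs_le.1 (hfl hy.le)
  have e2 := abs_le.1 (hfl le_rfl)
  have e3 := abs_le.1 (hil hy.le)
  have e4 := abs_le.1 (hil le_rfl)
  have e5 := abs_le.1 (h1.trans h2)
  have e6 : 10 * c / y₁ = c * (2 / y₁) + c * (2 / y₁) + c * (2 / y₁) + 2 * c * (2 / y₁) := by ring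
  have e7 : 2 * (2 / y₁) ≤ 2 * c * (2 / y₁) := by
    gcongr
    linarith
  have hc0 : (0 : ℝ) ≤ c := by linarith
  have m3 := mul_le_mul_of_nonneg_left e3.1 hc0
  have m3' := mul_le_mul_of_nonneg_left e3.2 hc0
  have m4 := mul_le_mul_of_nonneg_left e4.1 hc0
  have m4' := mul_le_mul_of_nonneg_left e4.2 hc0
  have m5 := mul_le_mul_of_nonneg_left e5.1 hc0
  have m5' := mul_le_mul_of_nonneg_left e5.2 hc0
  rw [abs_le]
  constructor <;> nlinarith

/-- The sum over `k` in terms of distribution in progressions of `⌊k ^ c⌋`. -/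
lemma abs_sum_div_totient_sub_le (c : ℝ) (hc : 1 < c) (y₁ y : ℝ) (h₁ : 2 ≤ y₁) (hy : y₁ < y)
    (𝔠 : ℝ) (D : ℕ) (M W E E' : ℝ)
    (hW0 : 0 ≤ W) (hE0 : 0 ≤ E)
    (hM : ∀ d : ℕ, 1 ≤ d → d ≤ D → ∀ b : ℤ, ⌊y₁⌋ ≤ b → b ≤ ⌊y⌋ →
      |(#{k ∈ Ioc ⌊y₁⌋ b | d ∣ ⌊((k : ℤ) : ℝ) ^ c⌋₊} : ℝ) - (b - ⌊y₁⌋) / d| ≤ M)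
    (hW : ∀ k ∈ Ioc ⌊y₁⌋ ⌊y⌋,
      (⌊(k : ℝ) ^ c⌋₊ : ℝ) / Nat.totient ⌊(k : ℝ) ^ c⌋₊ ≤ W)
    (hE : ∀ k ∈ Ioc ⌊y₁⌋ ⌊y⌋, |(⌊(k : ℝ) ^ c⌋₊ : ℝ) / Nat.totient ⌊(k : ℝ) ^ c⌋₊ -
      ∑ d ∈ Icc 1 D, (if d ∣ ⌊(k : ℝ) ^ c⌋₊ then sqfreeWeight d else 0)| ≤ E)
    (hE' : |𝔠 - ∑ d ∈ Icc 1 D, sqfreeWeight d / d| ≤ E') :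
    |∑ k ∈ Ioc ⌊y₁⌋ ⌊y⌋, c * (k : ℝ) ^ (c - 1) / (Nat.totient ⌊(k : ℝ) ^ c⌋₊ : ℝ) -
        𝔠 * Real.log ((⌊y ^ c⌋₊ : ℝ) / (⌊y₁ ^ c⌋₊ : ℝ))| ≤
      c * (y / y₁) * (2 * W / y₁ + E + E') + c * (D * (2 * M / y₁)) + |𝔠| * (10 * c / y₁) := by
  have hy0 : 0 < y₁ := by linarith
  have hc0 : 0 < c := by linarith
  set I := Ioc ⌊y₁⌋ ⌊y⌋ with hI
  set n : ℤ → ℕ := fun k => ⌊(k : ℝ) ^ c⌋₊ with hn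
  set H := ∑ k ∈ I, 1 / (k : ℝ) with hH
  have ha : 0 < ⌊y₁⌋ := Int.floor_pos.2 (by linarith)
  have hab : ⌊y₁⌋ ≤ ⌊y⌋ := Int.floor_mono hy.le
  have hk {k : ℤ} (hk : k ∈ I) : y₁ ≤ k := by
    have h : ⌊y₁⌋ + 1 ≤ k := (mem_Ioc.1 hk).1
    have h' : ((⌊y₁⌋ + 1 : ℤ) : ℝ) ≤ k := by exact_mod_cast h
    push_cast at h'
    linarith [Int.lt_floor_add_one y₁]
  have hHle : H ≤ y / y₁ := by
    calc H ≤ ∑ k ∈ I, 1 / y₁ := sum_le_sum fun k hkI => one_div_le_one_div_of_le hy0 (hk hkI)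
      _ = (#I : ℝ) / y₁ := by rw [sum_const, nsmul_eq_mul, mul_one_div]
      _ ≤ y / y₁ := by
        gcongr
        rw [hI, Int.card_Ioc]
        have h2 : (((⌊y⌋ - ⌊y₁⌋).toNat : ℤ) : ℝ) ≤ ⌊y⌋ := by
          rw [Int.toNat_of_nonneg (by omega)]
          exact_mod_cast (by omega : ⌊y⌋ - ⌊y₁⌋ ≤ ⌊y⌋)
        exact (by exact_mod_cast h2 : (((⌊y⌋ - ⌊y₁⌋).toNat : ℕ) : ℝ) ≤ ⌊y⌋).trans (Int.floor_le y)
  have hH0 : 0 ≤ H := sum_nonneg fun k hkI => by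
    have := hk hkI
    have : (0 : ℝ) < k := by linarith
    positivity
  have step1 : |∑ k ∈ I, c * (k : ℝ) ^ (c - 1) / (Nat.totient (n k) : ℝ) -
      ∑ k ∈ I, c * (1 / (k : ℝ)) * ((n k : ℝ) / Nat.totient (n k))| ≤ c * H * (2 * W / y₁) := by
    rw [← sum_sub_distrib, hH, mul_sum, sum_mul]
    refine (abs_sum_le_sum_abs _ _).trans (sum_le_sum fun k hkI => ?_)
    have hk1 := hk hkI
    have hk0 : (0 : ℝ) < k := by linarith
    have hkc : (k : ℝ) ≤ (k : ℝ) ^ c := by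
      simpa using Real.rpow_le_rpow_of_exponent_le (by linarith : (1 : ℝ) ≤ k) hc.le
    have hnl : (n k : ℝ) ≤ (k : ℝ) ^ c := Nat.floor_le (by linarith)
    have hnu : (k : ℝ) ^ c < n k + 1 := Nat.lt_floor_add_one _
    have hn0 : (0 : ℝ) < n k := by linarith
    have hφ : (0 : ℝ) < Nat.totient (n k) := by
      exact_mod_cast Nat.totient_pos.2 (by exact_mod_cast hn0)
    have hid : c * (k : ℝ) ^ (c - 1) / (Nat.totient (n k) : ℝ) -
        c * (1 / (k : ℝ)) * ((n k : ℝ) / Nat.totient (n k)) =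
        c * (1 / (k : ℝ)) * (((n k : ℝ) / Nat.totient (n k)) * (((k : ℝ) ^ c - n k) / n k)) := by
      rw [Real.rpow_sub_one hk0.ne']
      field_simp
    have hq0 : 0 ≤ ((k : ℝ) ^ c - n k) / n k := div_nonneg (by linarith) hn0.le
    have hq1 : ((k : ℝ) ^ c - n k) / n k ≤ 2 / y₁ := by
      rw [div_le_div_iff₀ hn0 hy0]
      nlinarith
    rw [hid, abs_of_nonneg (by positivity)]
    calc _ ≤ c * (1 / (k : ℝ)) * (W * (2 / y₁)) := by
          gcongr
          exact hW k hkI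
      _ = _ := by ring
  have step2 : |∑ k ∈ I, c * (1 / (k : ℝ)) * ((n k : ℝ) / Nat.totient (n k)) -
      ∑ k ∈ I, c * (1 / (k : ℝ)) * ∑ d ∈ Icc 1 D, (if d ∣ n k then sqfreeWeight d else 0)| ≤
      c * H * E := by
    rw [← sum_sub_distrib, hH, mul_sum, sum_mul]
    refine (abs_sum_le_sum_abs _ _).trans (sum_le_sum fun k hkI => ?_)
    have hk1 := hk hkI
    have hk0 : (0 : ℝ) < k := by linarith
    rw [← mul_sub, abs_mul, abs_of_nonneg (by positivity)]
    gcongr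
    exact hE k hkI
  have step3 : |∑ k ∈ I, c * (1 / (k : ℝ)) *
        ∑ d ∈ Icc 1 D, (if d ∣ n k then sqfreeWeight d else 0) -
      c * H * ∑ d ∈ Icc 1 D, sqfreeWeight d / d| ≤ c * (D * (2 * M / y₁)) := by
    have hswap : ∑ k ∈ I, c * (1 / (k : ℝ)) *
          ∑ d ∈ Icc 1 D, (if d ∣ n k then sqfreeWeight d else 0) -
        c * H * ∑ d ∈ Icc 1 D, sqfreeWeight d / d =
        c * ∑ d ∈ Icc 1 D, sqfreeWeight d *
          ∑ k ∈ I, ((if d ∣ n k then (1 : ℝ) else 0) - 1 / d) / k := by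
      rw [hH]
      simp only [mul_sum, sum_mul]
      rw [sum_comm, ← sum_sub_distrib]
      refine sum_congr rfl fun d _ => ?_
      rw [← sum_sub_distrib]
      refine sum_congr rfl fun k _ => ?_
      split_ifs <;> ring
    rw [hswap, abs_mul, abs_of_pos hc0]
    gcongr
    refine (abs_sum_le_sum_abs _ _).trans ?_
    calc _ ≤ ∑ d ∈ Icc 1 D, 2 * M / y₁ := by
          refine sum_le_sum fun d hd => ?_
          rw [mem_Icc] at hd
          have hM0 : 0 ≤ M := (abs_nonneg _).trans (hM d hd.1 hd.2 _ le_rfl hab)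
          rw [abs_mul, abs_of_nonneg (sqfreeWeight_nonneg d)]
          have hA := abs_sum_div_le_of_abs_sum_le
            (fun k => (if d ∣ n k then (1 : ℝ) else 0) - 1 / d) ⌊y₁⌋ ⌊y⌋ ha hab M
            fun b' h1 h2 => by
              have h3 := hM d hd.1 hd.2 b' h1 h2
              have h4 : ((#(Ioc ⌊y₁⌋ b') : ℕ) : ℝ) = b' - ⌊y₁⌋ := by
                have : ((#(Ioc ⌊y₁⌋ b') : ℕ) : ℤ) = b' - ⌊y₁⌋ := by
                  rw [Int.card_Ioc, Int.toNat_of_nonneg (by omega)]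
                exact_mod_cast this
              rw [sum_sub_distrib, sum_boole, sum_const, nsmul_eq_mul, h4, mul_one_div]
              exact h3
          refine (mul_le_of_le_one_left (abs_nonneg _) (sqfreeWeight_le_one d)).trans
            (hA.trans ?_)
          have ha' : (0 : ℝ) < ⌊y₁⌋ := by exact_mod_cast ha
          rw [div_le_div_iff₀ ha' hy0]
          nlinarith [Int.lt_floor_add_one y₁]
      _ = _ := by simp
  have step4 : |c * H * ∑ d ∈ Icc 1 D, sqfreeWeight d / d - c * H * 𝔠| ≤ c * H * E' := by
    rw [← mul_sub, abs_mul, abs_of_nonneg (by positivity), abs_sub_comm]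
    gcongr
  have step5 : |c * H * 𝔠 - 𝔠 * Real.log ((⌊y ^ c⌋₊ : ℝ) / (⌊y₁ ^ c⌋₊ : ℝ))| ≤
      |𝔠| * (10 * c / y₁) := by
    rw [mul_comm (c * H), ← mul_sub, abs_mul]
    gcongr
    exact abs_mul_sum_inv_sub_log_floor_le c hc y₁ y h₁ hy
  have hfin : c * H * (2 * W / y₁) + c * H * E + c * H * E' ≤
      c * (y / y₁) * (2 * W / y₁ + E + E') := by
    have : 0 ≤ E' := (abs_nonneg _).trans hE'
    rw [← mul_add, ← mul_add]
    gcongr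
  have t1 := abs_sub_le (∑ k ∈ I, c * (k : ℝ) ^ (c - 1) / (Nat.totient (n k) : ℝ))
    (∑ k ∈ I, c * (1 / (k : ℝ)) * ((n k : ℝ) / Nat.totient (n k)))
    (𝔠 * Real.log ((⌊y ^ c⌋₊ : ℝ) / (⌊y₁ ^ c⌋₊ : ℝ)))
  have t2 := abs_sub_le (∑ k ∈ I, c * (1 / (k : ℝ)) * ((n k : ℝ) / Nat.totient (n k)))
    (∑ k ∈ I, c * (1 / (k : ℝ)) * ∑ d ∈ Icc 1 D, (if d ∣ n k then sqfreeWeight d else 0))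
    (𝔠 * Real.log ((⌊y ^ c⌋₊ : ℝ) / (⌊y₁ ^ c⌋₊ : ℝ)))
  have t3 := abs_sub_le
    (∑ k ∈ I, c * (1 / (k : ℝ)) * ∑ d ∈ Icc 1 D, (if d ∣ n k then sqfreeWeight d else 0))
    (c * H * ∑ d ∈ Icc 1 D, sqfreeWeight d / d)
    (𝔠 * Real.log ((⌊y ^ c⌋₊ : ℝ) / (⌊y₁ ^ c⌋₊ : ℝ)))
  have t4 := abs_sub_le (c * H * ∑ d ∈ Icc 1 D, sqfreeWeight d / d) (c * H * 𝔠)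
    (𝔠 * Real.log ((⌊y ^ c⌋₊ : ℝ) / (⌊y₁ ^ c⌋₊ : ℝ)))
  linarith

/-- The asymptotic formula with a power saving, for `x = T ^ c` and `y₁ = T / L`. -/
lemma exists_eventually_abs_sum_div_totient_sub_le (c : ℝ) (hc : 1 < c)
    (hcne : ∀ n : ℤ, c ≠ n) :
    ∃ δ : ℝ, 0 < δ ∧ ∃ K : ℝ, 0 < K ∧ ∀ᶠ T : ℝ in atTop, ∀ L : ℝ, 1 ≤ L → 2 * L ≤ T ^ δ →
      ∀ y : ℝ, T / L < y → y ≤ T →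
      |∑ k ∈ Ioc ⌊T / L⌋ ⌊y⌋, c * (k : ℝ) ^ (c - 1) / (Nat.totient ⌊(k : ℝ) ^ c⌋₊ : ℝ) -
        frakc * Real.log ((⌊y ^ c⌋₊ : ℝ) / (⌊(T / L) ^ c⌋₊ : ℝ))| ≤ K * L ^ 2 * T ^ (-(δ / 4)) := by
  obtain ⟨δ, hδ0, hδ1, hCE⟩ := exists_abs_card_dvd_floor_rpow_sub_le c hc hcne
  have hc0 : 0 < c := by linarith
  have hε : 0 < δ / (4 * c) := by positivity
  obtain ⟨C₁, hC₁, h₁⟩ := exists_abs_div_totient_sub_sum_le _ hε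
  obtain ⟨C₂, hC₂, h₂⟩ := exists_div_totient_le _ hε
  obtain ⟨C₃, hC₃, h₃⟩ := exists_abs_tsum_sub_sum_le
  refine ⟨δ, hδ0, c * (2 * C₂ + C₁ + C₃) + c * 168 + |frakc| * (10 * c), by positivity, ?_⟩
  filter_upwards [hCE, eventually_ge_atTop 1] with T hT hT1 L hL hLT y hy hyT
  have hT0 : 0 < T := by linarith
  have hL0 : 0 < L := by linarith
  have hmono {u v : ℝ} (h : u ≤ v) : T ^ u ≤ T ^ v := Real.rpow_le_rpow_of_exponent_le hT1 h
  have hy₁ : 2 * T ^ (1 - δ) ≤ T / L := by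
    rw [le_div_iff₀ hL0]
    calc 2 * T ^ (1 - δ) * L = T ^ (1 - δ) * (2 * L) := by ring
      _ ≤ T ^ (1 - δ) * T ^ δ := by gcongr
      _ = T := by rw [← Real.rpow_add hT0, sub_add_cancel, Real.rpow_one]
  have hone : 1 ≤ T ^ (1 - δ) := Real.one_le_rpow hT1 (by linarith)
  have hy₂ : 2 ≤ T / L := by linarith
  have hy0 : 0 < T / L := by linarith
  set D : ℕ := ⌊T ^ δ⌋₊ with hD
  have hDle : (D : ℝ) ≤ T ^ δ := Nat.floor_le (by positivity)
  have hDlt : T ^ δ < D + 1 := Nat.lt_floor_add_one _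
  have hn {k : ℤ} (hk : k ∈ Ioc ⌊T / L⌋ ⌊y⌋) :
      ⌊(k : ℝ) ^ c⌋₊ ≠ 0 ∧ ((⌊(k : ℝ) ^ c⌋₊ : ℕ) : ℝ) ^ (δ / (4 * c)) ≤ T ^ (δ / 4) := by
    rw [mem_Ioc, Int.floor_lt, Int.le_floor] at hk
    have hk1 : (1 : ℝ) ≤ k := by linarith
    have hkT : (k : ℝ) ≤ T := by linarith
    refine ⟨(Nat.floor_pos.2 (Real.one_le_rpow hk1 hc0.le)).ne', ?_⟩
    calc ((⌊(k : ℝ) ^ c⌋₊ : ℕ) : ℝ) ^ (δ / (4 * c)) ≤ (T ^ c) ^ (δ / (4 * c)) := by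
          gcongr
          exact (Nat.floor_le (by positivity)).trans (by gcongr)
      _ = T ^ (δ / 4) := by
        rw [← Real.rpow_mul hT0.le]
        congr 1
        field_simp
  have main := abs_sum_div_totient_sub_le c hc (T / L) y hy₂ hy frakc D (84 * T ^ (1 - 2 * δ))
    (C₂ * T ^ (δ / 4)) (C₁ * T ^ (-(δ / 4))) (C₃ * T ^ (-(δ / 4))) (by positivity) (by positivity)
    (fun d hd hdD b hab hby => hT d hd (hDle.trans' (by exact_mod_cast hdD)) _ b
      (by linarith [Int.lt_floor_add_one (T / L)])
      ((Int.le_floor.1 hby).trans hyT) hab)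
    (fun k hk => (h₂ _ (hn hk).1).trans (by gcongr; exact (hn hk).2))
    (fun k hk => (h₁ _ (hn hk).1 D).trans ?_)
    (by
      refine (h₃ D).trans ?_
      gcongr
      calc ((D : ℝ) + 1) ^ (-(1 / 4 : ℝ)) ≤ (T ^ δ) ^ (-(1 / 4 : ℝ)) :=
            Real.rpow_le_rpow_of_nonpos (by positivity) hDlt.le (by norm_num)
        _ = _ := by
          rw [← Real.rpow_mul hT0.le]
          ring_nf)
  · refine main.trans ?_
    have hinv : 1 / (T / L) = L * T ^ (-1 : ℝ) := by
      rw [Real.rpow_neg_one]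
      field_simp
    have e1 : y / (T / L) ≤ L := by
      rw [div_le_iff₀ hy0]
      exact hyT.trans (le_of_eq (by field_simp))
    have e2 : 2 * (C₂ * T ^ (δ / 4)) / (T / L) ≤ 2 * C₂ * L * T ^ (-(δ / 4)) := by
      rw [div_eq_mul_one_div, hinv]
      calc _ = 2 * C₂ * L * (T ^ (δ / 4) * T ^ (-1 : ℝ)) := by ring
        _ ≤ _ := by
          rw [← Real.rpow_add hT0]
          gcongr
          linarith
    have e3 : (D : ℝ) * (2 * (84 * T ^ (1 - 2 * δ)) / (T / L)) ≤ 168 * L * T ^ (-(δ / 4)) := by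
      rw [div_eq_mul_one_div, hinv]
      calc (D : ℝ) * (2 * (84 * T ^ (1 - 2 * δ)) * (L * T ^ (-1 : ℝ)))
          ≤ T ^ δ * (2 * (84 * T ^ (1 - 2 * δ)) * (L * T ^ (-1 : ℝ))) := by gcongr
        _ = 168 * L * (T ^ δ * T ^ (1 - 2 * δ) * T ^ (-1 : ℝ)) := by ring
        _ ≤ _ := by
          rw [← Real.rpow_add hT0, ← Real.rpow_add hT0]
          gcongr
          linarith
    have e4 : 10 * c / (T / L) ≤ 10 * c * L * T ^ (-(δ / 4)) := by
      rw [div_eq_mul_one_div, hinv, ← mul_assoc]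
      gcongr
      linarith
    have hX : 0 < T ^ (-(δ / 4)) := by positivity
    have hLL : L ≤ L ^ 2 := by nlinarith
    calc _ ≤ c * L * (2 * C₂ * L * T ^ (-(δ / 4)) + C₁ * T ^ (-(δ / 4)) + C₃ * T ^ (-(δ / 4))) +
          c * (168 * L * T ^ (-(δ / 4))) + |frakc| * (10 * c * L * T ^ (-(δ / 4))) := by gcongr
      _ = (c * (2 * C₂ * L ^ 2 + C₁ * L + C₃ * L) + c * 168 * L + |frakc| * (10 * c) * L) *
          T ^ (-(δ / 4)) := by ring
      _ ≤ (c * (2 * C₂ * L ^ 2 + C₁ * L ^ 2 + C₃ * L ^ 2) + c * 168 * L ^ 2 +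
          |frakc| * (10 * c) * L ^ 2) * T ^ (-(δ / 4)) := by gcongr
      _ = _ := by ring
  · calc C₁ * ((⌊(k : ℝ) ^ c⌋₊ : ℕ) : ℝ) ^ (δ / (4 * c)) * ((D : ℝ) + 1) ^ (-(1 / 2 : ℝ))
        ≤ C₁ * T ^ (δ / 4) * (T ^ δ) ^ (-(1 / 2 : ℝ)) := by
          have := Real.rpow_le_rpow_of_nonpos (by positivity) hDlt.le
            (by norm_num : (-(1 / 2 : ℝ)) ≤ 0)
          have := (hn hk).2
          gcongr
      _ = C₁ * (T ^ (δ / 4) * T ^ (δ * -(1 / 2))) := by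
        rw [← Real.rpow_mul hT0.le]
        ring
      _ = _ := by
        rw [← Real.rpow_add hT0]
        ring_nf

end

theorem statement16 (c : ℝ) (hc : 1 < c) (hcne : ∀ n : ℤ, c ≠ (n : ℝ)) (A : ℝ) (hA : 1 < A) :
    ∃ B : ℝ, 0 < B ∧ ∃ κ > (0:ℝ), ∃ x₀ : ℝ, 2 ≤ x₀ ∧ ∀ x : ℝ, x₀ ≤ x →
      ∀ y₁ : ℝ, 0 < y₁ → y₁ ^ c = x * Real.log x ^ (-B) →
        ∀ y : ℝ, y₁ < y → y ^ c ≤ x →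
          |(∑ k ∈ Finset.Ioc ⌊y₁⌋ ⌊y⌋,
                c * (k : ℝ) ^ (c - 1) / (Nat.totient ⌊(k : ℝ) ^ c⌋₊ : ℝ))
              - frakc * Real.log ((⌊y ^ c⌋₊ : ℝ) / (⌊y₁ ^ c⌋₊ : ℝ))|
            ≤ κ * Real.log x ^ (-A) := by
  obtain ⟨δ, hδ, K, hK, hev⟩ := exists_eventually_abs_sum_div_totient_sub_le c hc hcne
  have hc0 : 0 < c := by linarith
  have hT :
      Filter.Tendsto (fun x : ℝ => x ^ (1 / c)) Filter.atTop Filter.atTop :=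
    tendsto_rpow_atTop (by positivity)
  have hlog := Real.tendsto_log_atTop.eventually_ge_atTop 1
  have hpow := (isLittleO_log_rpow_rpow_atTop (A + 2)
    (by positivity : 0 < 1 / c * (δ / 4))).bound one_pos
  have hlin := (isLittleO_log_rpow_rpow_atTop 1 (by positivity : 0 < 1 / c * δ)).bound
    (by norm_num : (0 : ℝ) < 1 / 2)
  obtain ⟨x₀, hx₀⟩ := Filter.eventually_atTop.1
    ((hT.eventually hev).and (hlog.and (hpow.and hlin)))
  refine ⟨c, hc0, K, hK, max 2 x₀, le_max_left _ _, fun x hx y₁ hy₁ hy₁c y hy hyx => ?_⟩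
  obtain ⟨h1, h2, h3, h4⟩ := hx₀ x ((le_max_right _ _).trans hx)
  have hx0 : 0 < x := by linarith [(le_max_left 2 x₀).trans hx]
  have hL0 : 0 < Real.log x := by linarith
  rw [Real.norm_of_nonneg (by positivity), Real.norm_of_nonneg (by positivity),
    Real.rpow_mul hx0.le] at h3 h4
  rw [Real.rpow_one] at h4
  have hy₁eq : y₁ = x ^ (1 / c) / Real.log x := by
    have hinj : y₁ ^ c = (x ^ (1 / c) / Real.log x) ^ c := by
      rw [hy₁c, Real.div_rpow (by positivity) hL0.le, ← Real.rpow_mul hx0.le,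
        one_div_mul_cancel hc0.ne', Real.rpow_one, Real.rpow_neg hL0.le, div_eq_mul_inv]
    exact (Real.rpow_left_inj hy₁.le (by positivity) hc0.ne').1 hinj
  have hyT : y ≤ x ^ (1 / c) := by
    have hy0 : 0 < y := hy₁.trans hy
    rw [← Real.rpow_rpow_inv hy0.le hc0.ne', one_div]
    gcongr
  subst hy₁eq
  refine (h1 _ h2 (by linarith) y hy hyT).trans ?_
  rw [mul_assoc]
  gcongr
  have hT0 : 0 < (x ^ (1 / c)) ^ (δ / 4) := by positivity
  rw [Real.rpow_neg (by positivity), ← div_eq_mul_inv, div_le_iff₀ hT0]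
  rw [one_mul] at h3
  calc Real.log x ^ 2 = Real.log x ^ (-A) * Real.log x ^ (A + 2) := by
        rw [← Real.rpow_add hL0, neg_add_cancel_left, Real.rpow_two]
    _ ≤ _ := by gcongr
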